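/- arXiv:1902.03228 — 11 statements merged into one kernel-verified Lean document; each statement's English description precedes it below -/
import Mathlib

section
/- Let m ≥ 1, z ∈ ℝ^m and μ > 0, and let u* = proj_Δ(z/μ) be the Euclidean projection of z/μ onto the standard simplex Δ^{m−1}. For k ∈ {1, …, m}, u* has exactly k nonzero entries if and only if Σ_{i=1}^k (z_{(i)} − z_{(k)}) < μ ≤ Σ_{i=1}^k (z_{(i)} − z_{(k+1)}), where z_{(m+1)} := −∞ (so the upper inequality is void when k = m). Moreover, in that case u*_i = max{ 0, (1/(kμ)) Σ_{j=1}^k (z_i − z_{(j)}) + 1/k } for every i ∈ {1, …, m}. -/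
noncomputable section

/-- The standard simplex `Δ^{m-1}` viewed inside Euclidean space `ℝ^m`. -/
def simplexSet (m : ℕ) : Set (EuclideanSpace ℝ (Fin m)) :=
  {u | (∀ i, 0 ≤ u i) ∧ ∑ i, u i = 1}

/-- The Euclidean projection onto the simplex is a soft thresholding of the projected point. -/
theorem exists_threshold_of_simplex_projection {m : ℕ} (w u : EuclideanSpace ℝ (Fin m))
    (hu : u ∈ simplexSet m) (hproj : ∀ v ∈ simplexSet m, ‖u - w‖ ≤ ‖v - w‖) :
    ∃ τ : ℝ, ∀ i, u i = max 0 (w i - τ) := by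
  have hconv : Convex ℝ (simplexSet m) := by
    intro x hx y hy a b ha hb hab
    refine ⟨fun i => ?_, ?_⟩
    · have h₁ := mul_nonneg ha (hx.1 i)
      have h₂ := mul_nonneg hb (hy.1 i)
      simpa using add_nonneg h₁ h₂
    · simp [Finset.sum_add_distrib, ← Finset.mul_sum, hx.2, hy.2, hab]
  have hinf : ‖w - u‖ = ⨅ v : simplexSet m, ‖w - v‖ := by
    have : Nonempty (simplexSet m) := ⟨⟨u, hu⟩⟩
    refine le_antisymm (le_ciInf fun v => ?_) ?_
    · rw [norm_sub_rev w u, norm_sub_rev w]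
      exact hproj v v.2
    · exact ciInf_le (f := fun v : simplexSet m => ‖w - v‖)
        ⟨0, by rintro _ ⟨v, rfl⟩; exact norm_nonneg _⟩ ⟨u, hu⟩
  have hvar := (norm_eq_iInf_iff_real_inner_le_zero hconv hu).1 hinf
  set τ : ℝ := ∑ i, u i * (w i - u i) with hτ
  have hle : ∀ j, w j - u j ≤ τ := by
    intro j
    have hmem : EuclideanSpace.single j (1 : ℝ) ∈ simplexSet m := by
      refine ⟨fun i => ?_, ?_⟩
      · by_cases h : i = j <;> simp [h]
      · simp
    have h := hvar _ hmem
    rw [inner_sub_right, EuclideanSpace.inner_single_right] at h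
    have h' : inner ℝ (w - u) u = τ := by
      simp [PiLp.inner_apply, hτ]
    rw [h'] at h
    simpa using h
  have hzero : ∑ i, u i * (τ - (w i - u i)) = 0 := by
    simp only [mul_sub _ τ, Finset.sum_sub_distrib, ← Finset.sum_mul, hu.2, ← hτ]
    ring
  have heq := (Finset.sum_eq_zero_iff_of_nonneg
    fun i _ => mul_nonneg (hu.1 i) (sub_nonneg.2 (hle i))).1 hzero
  refine ⟨τ, fun i => ?_⟩
  rcases mul_eq_zero.1 (heq i (Finset.mem_univ i)) with h | h
  · have := hle i
    rw [max_eq_left] <;> linarith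
  · have := hu.1 i
    rw [max_eq_right] <;> linarith

/-- If the positive parts of `a i - τ` sum to a positive number, then raising the threshold strictly
lowers the sum, and lowering it does not. -/
theorem sum_posPart_sub_lt_iff {ι : Type*} [Fintype ι] (a : ι → ℝ) (τ t : ℝ)
    (hpos : 0 < ∑ i, max 0 (a i - τ)) :
    ∑ i, max 0 (a i - t) < ∑ i, max 0 (a i - τ) ↔ τ < t := by
  constructor
  · contrapose!
    intro h
    gcongr
  · intro h
    obtain ⟨i, hi, hlt⟩ := Finset.exists_lt_of_sum_lt (s := Finset.univ) (f := fun _ : ι => (0 : ℝ))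
      (by simpa using hpos)
    refine Finset.sum_lt_sum (fun j _ => by gcongr) ⟨i, hi, ?_⟩
    have hi' : 0 < a i - τ := by simpa using hlt
    rw [max_eq_right hi'.le]
    exact max_lt hi' (by linarith)

/-- An index lies below the number of entries of an antitone tuple exceeding `τ` exactly when
its own entry exceeds `τ`. -/
theorem Antitone.lt_card_filter_lt_iff {m : ℕ} {a : Fin m → ℝ} (ha : Antitone a) (τ : ℝ)
    (p : Fin m) : (p : ℕ) < (Finset.univ.filter fun i => τ < a i).card ↔ τ < a p := by
  constructor
  · contrapose!
    intro h
    rw [← Fin.card_Iio p]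
    refine Finset.card_le_card fun i hi => ?_
    simp only [Finset.mem_filter, Finset.mem_univ, true_and] at hi
    rw [Finset.mem_Iio]
    by_contra! hpi
    exact absurd (ha hpi) (by linarith)
  · intro h
    have : (Finset.Iic p).card ≤ (Finset.univ.filter fun i => τ < a i).card := by
      refine Finset.card_le_card fun i hi => ?_
      rw [Finset.mem_Iic] at hi
      simpa using h.trans_le (ha hi)
    rw [Fin.card_Iic] at this
    omega

/-- A sum of positive parts is the sum over the initial segment where they are nonnegative. -/
theorem sum_posPart_sub_eq_sum_filter {m : ℕ} (a : Fin m → ℝ) (t : ℝ) (k : ℕ)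
    (hlt : ∀ i : Fin m, (i : ℕ) < k → t ≤ a i) (hge : ∀ i : Fin m, k ≤ (i : ℕ) → a i ≤ t) :
    ∑ i, max 0 (a i - t) = ∑ i ∈ Finset.univ.filter (fun i : Fin m => (i : ℕ) < k), (a i - t) := by
  rw [Finset.sum_filter]
  refine Finset.sum_congr rfl fun i _ => ?_
  split_ifs with h
  · exact max_eq_right (sub_nonneg.2 (hlt i h))
  · exact max_eq_left (sub_nonpos.2 (hge i (not_lt.1 h)))

/-- Characterization of the support size of the Euclidean projection of `z/μ` onto the
standard simplex, together with the closed-form expression for the projection.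
`σ` is any permutation arranging the entries of `z` in nonincreasing order, so that
`z (σ i)` is the `(i+1)`-th largest entry `z_{(i+1)}`. -/
theorem simplex_projection_support {m : ℕ} (hm : 1 ≤ m)
    (z : EuclideanSpace ℝ (Fin m)) (μ : ℝ) (hμ : 0 < μ)
    (u : EuclideanSpace ℝ (Fin m)) (hu : u ∈ simplexSet m)
    (hproj : ∀ v ∈ simplexSet m, ‖u - μ⁻¹ • z‖ ≤ ‖v - μ⁻¹ • z‖)
    (σ : Equiv.Perm (Fin m)) (hσ : ∀ i j : Fin m, i ≤ j → z (σ j) ≤ z (σ i))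
    (k : ℕ) (hk1 : 1 ≤ k) (hkm : k ≤ m) :
    ((Finset.filter (fun i : Fin m => u i ≠ 0) Finset.univ).card = k ↔
      ((∑ i ∈ Finset.filter (fun i : Fin m => (i : ℕ) < k) Finset.univ,
          (z (σ i) - z (σ ⟨k - 1, by omega⟩))) < μ ∧
        ∀ hlt : k < m,
          μ ≤ ∑ i ∈ Finset.filter (fun i : Fin m => (i : ℕ) < k) Finset.univ,
                (z (σ i) - z (σ ⟨k, hlt⟩))))
    ∧ ((Finset.filter (fun i : Fin m => u i ≠ 0) Finset.univ).card = k →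
        ∀ i : Fin m, u i =
          max 0 (1 / ((k : ℝ) * μ) *
            (∑ j ∈ Finset.filter (fun j : Fin m => (j : ℕ) < k) Finset.univ,
              (z i - z (σ j))) + 1 / (k : ℝ))) := by
  obtain ⟨τ, hτ⟩ := exists_threshold_of_simplex_projection (μ⁻¹ • z) u hu hproj
  set a : Fin m → ℝ := fun i => μ⁻¹ * z (σ i) with ha_def
  have ha : Antitone a := fun i j hij =>
    mul_le_mul_of_nonneg_left (hσ i j hij) (inv_nonneg.2 hμ.le)
  have huσ : ∀ i, u (σ i) = max 0 (a i - τ) := fun i => by simpa [ha_def] using hτ (σ i)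
  have hone : ∑ i, max 0 (a i - τ) = 1 := by
    rw [← hu.2, ← Equiv.sum_comp σ u]
    exact Finset.sum_congr rfl fun i _ => (huσ i).symm
  have hthr : ∀ t, ∑ i, max 0 (a i - t) < 1 ↔ τ < t := fun t => by
    have h := sum_posPart_sub_lt_iff a τ t (by rw [hone]; exact one_pos)
    rwa [hone] at h
  have hcard : (Finset.univ.filter fun i : Fin m => u i ≠ 0).card =
      (Finset.univ.filter fun i => τ < a i).card := by
    symm
    refine Finset.card_equiv σ fun i => ?_
    simp only [Finset.mem_filter, Finset.mem_univ, true_and, huσ]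
    rw [ne_eq, max_eq_left_iff, not_le, sub_pos]
  have hz : ∀ i, z (σ i) = μ * a i := fun i => by
    simp only [ha_def]
    field_simp
  have hscale : ∀ p : Fin m, k ≤ (p : ℕ) + 1 → (p : ℕ) ≤ k →
      ∑ i ∈ Finset.univ.filter (fun i : Fin m => (i : ℕ) < k), (z (σ i) - z (σ p)) =
        μ * ∑ i, max 0 (a i - a p) := by
    intro p h₁ h₂
    rw [sum_posPart_sub_eq_sum_filter a (a p) k
      (fun i hi => ha (Fin.le_def.2 (by omega))) (fun i hi => ha (Fin.le_def.2 (by omega))),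
      Finset.mul_sum]
    exact Finset.sum_congr rfl fun i _ => by rw [hz, hz]; ring
  have hupper : (∑ i ∈ Finset.univ.filter (fun i : Fin m => (i : ℕ) < k),
      (z (σ i) - z (σ ⟨k - 1, by omega⟩))) < μ ↔
      k - 1 < (Finset.univ.filter fun i => τ < a i).card := by
    rw [hscale _ (by simp only; omega) (by simp only; omega), mul_lt_iff_lt_one_right hμ, hthr]
    exact (ha.lt_card_filter_lt_iff τ ⟨k - 1, by omega⟩).symm
  have hlower : ∀ hlt : k < m,
      μ ≤ ∑ i ∈ Finset.univ.filter (fun i : Fin m => (i : ℕ) < k),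
        (z (σ i) - z (σ ⟨k, hlt⟩)) ↔
      (Finset.univ.filter fun i => τ < a i).card ≤ k := by
    intro hlt
    rw [hscale _ (by simp only; omega) le_rfl, ← not_lt, mul_lt_iff_lt_one_right hμ, hthr,
      ← ha.lt_card_filter_lt_iff τ ⟨k, hlt⟩, not_lt]
  have hcard_le : (Finset.univ.filter fun i => τ < a i).card ≤ m :=
    (Finset.card_le_univ _).trans_eq (Fintype.card_fin m)
  rw [hcard]
  refine ⟨?_, fun hk i => ?_⟩
  · rw [hupper, forall_congr' hlower]
    constructor
    · intro h
      exact ⟨by omega, fun _ => h.le⟩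
    · rintro ⟨h₁, h₂⟩
      rcases hkm.lt_or_eq with h | h
      · have := h₂ h
        omega
      · omega
  · have hsum : ∑ j ∈ Finset.univ.filter (fun j : Fin m => (j : ℕ) < k), (a j - τ) = 1 := by
      rw [← sum_posPart_sub_eq_sum_filter a τ k _ _, hone]
      · intro j hj
        exact ((ha.lt_card_filter_lt_iff τ j).1 (by omega)).le
      · intro j hj
        exact not_lt.1 fun h => absurd ((ha.lt_card_filter_lt_iff τ j).2 h) (by omega)
    have hcount : (Finset.univ.filter fun j : Fin m => (j : ℕ) < k).card = k := by
      rw [Fin.card_filter_val_lt, min_eq_right hkm]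
    have hk0 : (k : ℝ) ≠ 0 := by positivity
    rw [hτ i]
    congr 1
    simp only [Finset.sum_sub_distrib, Finset.sum_const, hcount, nsmul_eq_mul, hz,
      ← Finset.mul_sum] at hsum ⊢
    rw [eq_add_of_sub_eq hsum]
    simp only [PiLp.smul_apply, smul_eq_mul]
    field_simp
    ring
end
end

section
/- Let m ≥ 2, z ∈ ℝ^m, K ∈ {1, …, m−1} and μ > 0. If μ ≤ Σ_{i=1}^K (z_{(i)} − z_{(K+1)}), then the Euclidean projection proj_Δ(z/μ) of z/μ onto the standard simplex Δ^{m−1} has at most K nonzero entries. In particular, if z_{(1)} > z_{(K+1)}, then for every μ with 0 < μ ≤ z_{(1)} − z_{(K+1)}, the projection proj_Δ(z/μ) has at most K nonzero entries. -/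
noncomputable section

theorem convex_simplexSet (m : ℕ) : Convex ℝ (simplexSet m) := by
  rintro x ⟨hx, hx1⟩ y ⟨hy, hy1⟩ a b ha hb hab
  refine ⟨fun i => ?_, ?_⟩
  · have := mul_nonneg ha (hx i)
    have := mul_nonneg hb (hy i)
    simpa using by linarith
  · simp [Finset.sum_add_distrib, ← Finset.mul_sum, hx1, hy1, hab]

/-- The variational inequality for a nearest point of a convex set. -/
theorem inner_sub_nonpos_of_forall_norm_le {E : Type*} [NormedAddCommGroup E]
    [InnerProductSpace ℝ E] {S : Set E} (hS : Convex ℝ S) {u w : E} (hu : u ∈ S)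
    (hmin : ∀ v ∈ S, ‖u - w‖ ≤ ‖v - w‖) {v : E} (hv : v ∈ S) :
    inner ℝ (w - u) (v - u) ≤ 0 := by
  refine (norm_eq_iInf_iff_real_inner_le_zero hS hu).1 ?_ v hv
  have : Nonempty S := ⟨⟨u, hu⟩⟩
  refine le_antisymm (le_ciInf fun v => ?_) ?_
  · rw [norm_sub_rev w u, norm_sub_rev w v]
    exact hmin v v.2
  · exact ciInf_le (f := fun v : S => ‖w - v‖)
      ⟨0, by rintro _ ⟨v, rfl⟩; exact norm_nonneg _⟩ ⟨u, hu⟩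

/-- Optimality condition for the projection onto the simplex: the residual `w - u` is maximal
at every coordinate where `u` does not vanish. -/
theorem residual_le_of_ne_zero {m : ℕ} {u w : EuclideanSpace ℝ (Fin m)}
    (hu : u ∈ simplexSet m) (hmin : ∀ v ∈ simplexSet m, ‖u - w‖ ≤ ‖v - w‖)
    {p : Fin m} (hp : u p ≠ 0) (j : Fin m) : w j - u j ≤ w p - u p := by
  have hpos : 0 < u p := lt_of_le_of_ne (hu.1 p) hp.symm
  set d : EuclideanSpace ℝ (Fin m) :=
    EuclideanSpace.single j (u p) - EuclideanSpace.single p (u p) with hd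
  have hmem : u + d ∈ simplexSet m := by
    refine ⟨fun i => ?_, ?_⟩
    · have hi := hu.1 i
      by_cases hip : i = p
      · subst hip
        by_cases hij : i = j
        · subst hij
          simpa [hd] using hi
        · simp [hd, hij]
      · by_cases hij : i = j
        · subst hij
          simpa [hd, hip] using add_nonneg hi hpos.le
        · simp [hd, hij, hip, hi]
    · simp [hd, Finset.sum_add_distrib, hu.2]
  have h := inner_sub_nonpos_of_forall_norm_le (convex_simplexSet m) hu hmin hmem
  rw [add_sub_cancel_left, hd, inner_sub_right, EuclideanSpace.inner_single_right,
    EuclideanSpace.inner_single_right] at h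
  simp only [PiLp.sub_apply, conj_trivial, ← mul_sub] at h
  linarith [nonpos_of_mul_nonpos_right h hpos]

theorem card_support_le_of_le_sum_sub {m : ℕ} (z : EuclideanSpace ℝ (Fin m))
    (σ : Equiv.Perm (Fin m)) (hσ : ∀ i j : Fin m, i ≤ j → z (σ j) ≤ z (σ i))
    (k : Fin m) (hk : 1 ≤ (k : ℕ)) {μ : ℝ} (hμ : 0 < μ)
    (hsum : μ ≤ ∑ i ∈ Finset.filter (fun i : Fin m => (i : ℕ) < k) Finset.univ,
      (z (σ i) - z (σ k)))
    {u : EuclideanSpace ℝ (Fin m)} (hu : u ∈ simplexSet m)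
    (hmin : ∀ v ∈ simplexSet m, ‖u - μ⁻¹ • z‖ ≤ ‖v - μ⁻¹ • z‖) :
    (Finset.filter (fun i : Fin m => u i ≠ 0) Finset.univ).card ≤ k := by
  by_contra! hcard
  set T := Finset.filter (fun i : Fin m => (i : ℕ) < k) Finset.univ with hT
  have hTcard : T.card = k := by
    have : T = Finset.Iio k := by ext i; simp [hT]
    rw [this, Fin.card_Iio]
  obtain ⟨p, hp, hpT⟩ := Finset.exists_mem_notMem_of_card_lt_card
    (s := T.map σ.toEmbedding)
    (t := Finset.filter (fun i : Fin m => u i ≠ 0) Finset.univ) (by rwa [Finset.card_map, hTcard])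
  have hup : u p ≠ 0 := by simpa using hp
  have hpos : 0 < u p := lt_of_le_of_ne (hu.1 p) hup.symm
  have hzp : z p ≤ z (σ k) := by
    have hkp : k ≤ σ.symm p := by
      by_contra! hlt
      exact hpT (Finset.mem_map.2 ⟨σ.symm p, by simpa [hT] using hlt, by simp⟩)
    simpa using hσ _ _ hkp
  have hlt : ∀ i ∈ T, μ⁻¹ * (z (σ i) - z (σ k)) < u (σ i) := by
    intro i _
    have h := residual_le_of_ne_zero hu hmin hup (σ i)
    simp only [PiLp.smul_apply, smul_eq_mul] at h
    have := mul_le_mul_of_nonneg_left hzp (inv_pos.2 hμ).le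
    linarith
  have hne : T.Nonempty := Finset.card_pos.1 (by omega)
  have h1 : μ⁻¹ * ∑ i ∈ T, (z (σ i) - z (σ k)) < ∑ i ∈ T, u (σ i) := by
    rw [Finset.mul_sum]
    exact Finset.sum_lt_sum_of_nonempty hne hlt
  have h2 : ∑ i ∈ T, u (σ i) ≤ 1 := by
    rw [← hu.2, ← Equiv.sum_comp σ]
    exact Finset.sum_le_sum_of_subset_of_nonneg (Finset.subset_univ _) fun i _ _ => hu.1 _
  have h3 : 1 ≤ μ⁻¹ * ∑ i ∈ T, (z (σ i) - z (σ k)) := by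
    rw [← inv_mul_cancel₀ hμ.ne']
    exact mul_le_mul_of_nonneg_left hsum (inv_pos.2 hμ).le
  linarith

/-- If `μ ≤ Σ_{i=1}^K (z_{(i)} − z_{(K+1)})` then the Euclidean projection of `z/μ` onto the
standard simplex has at most `K` nonzero entries; in particular this holds whenever
`z_{(1)} > z_{(K+1)}` and `0 < μ ≤ z_{(1)} − z_{(K+1)}`.
`σ` is any permutation arranging the entries of `z` in nonincreasing order, so that
`z (σ i)` is the `(i+1)`-th largest entry `z_{(i+1)}`. -/
theorem topK_exactness {m : ℕ} (hm : 2 ≤ m) (z : EuclideanSpace ℝ (Fin m))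
    (σ : Equiv.Perm (Fin m)) (hσ : ∀ i j : Fin m, i ≤ j → z (σ j) ≤ z (σ i))
    (K : ℕ) (hK1 : 1 ≤ K) (hKm : K ≤ m - 1) :
    (∀ μ : ℝ, 0 < μ →
      μ ≤ (∑ i ∈ Finset.filter (fun i : Fin m => (i : ℕ) < K) Finset.univ,
            (z (σ i) - z (σ ⟨K, by omega⟩))) →
      ∀ u ∈ simplexSet m, (∀ v ∈ simplexSet m, ‖u - μ⁻¹ • z‖ ≤ ‖v - μ⁻¹ • z‖) →
        (Finset.filter (fun i : Fin m => u i ≠ 0) Finset.univ).card ≤ K)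
    ∧ (z (σ ⟨0, by omega⟩) > z (σ ⟨K, by omega⟩) →
        ∀ μ : ℝ, 0 < μ → μ ≤ z (σ ⟨0, by omega⟩) - z (σ ⟨K, by omega⟩) →
          ∀ u ∈ simplexSet m, (∀ v ∈ simplexSet m, ‖u - μ⁻¹ • z‖ ≤ ‖v - μ⁻¹ • z‖) →
            (Finset.filter (fun i : Fin m => u i ≠ 0) Finset.univ).card ≤ K) := by
  refine ⟨fun μ hμ hsum u hu hmin =>
    card_support_le_of_le_sum_sub z σ hσ ⟨K, by omega⟩ hK1 hμ hsum hu hmin,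
    fun _ μ hμ hle u hu hmin =>
    card_support_le_of_le_sum_sub z σ hσ ⟨K, by omega⟩ hK1 hμ (hle.trans ?_) hu hmin⟩
  refine Finset.single_le_sum (f := fun i : Fin m => z (σ i) - z (σ ⟨K, by omega⟩))
    (fun i hi => sub_nonneg.2 (hσ _ _ ?_)) ?_
  · exact Fin.le_def.2 (Finset.mem_filter.1 hi).2.le
  · exact Finset.mem_filter.2 ⟨Finset.mem_univ _, hK1⟩
end
end

section
/- In the abstract Casimir setting, for every k ≥ 1 the iterate w_k satisfies F(w_k) − F* ≤ ( Π_{r=0}^{k−1}(1 − α_r) / Π_{r=1}^{k}(1 − δ_r) ) · Δ₀ + μ_k D + Σ_{j=1}^{k} ( Π_{r=j}^{k−1}(1 − α_r) / Π_{r=j}^{k}(1 − δ_r) ) · ( μ_{j−1} − (1 − δ_j) μ_j ) · D, where Δ₀ = F(w₀) − F* + ( ((κ₁ + λ) α₀² − λ α₀) / (2(1 − α₀)) ) · ‖w₀ − w*‖₂², μ₀ := 2 μ₁, and the empty product Π_{r=k}^{k−1}(1 − α_r) equals 1. -/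
section InnerProductSpace

variable {E : Type*} [NormedAddCommGroup E] [InnerProductSpace ℝ E]

lemma norm_smul_add_smul_sq (a b : ℝ) (p q : E) :
    ‖a • p + b • q‖ ^ 2 = (a + b) * (a * ‖p‖ ^ 2 + b * ‖q‖ ^ 2) - a * b * ‖p - q‖ ^ 2 := by
  rw [norm_add_sq_real, norm_sub_sq_real, norm_smul, norm_smul, inner_smul_left, inner_smul_right,
    mul_pow, mul_pow, Real.norm_eq_abs, Real.norm_eq_abs, sq_abs, sq_abs]
  simp only [conj_trivial]
  ring

/-- An inexact proximal point with error relative to the displacement satisfies a three-point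
inequality whose strong convexity term is damped by the relative error. -/
lemma inexact_prox_three_point {f : E → ℝ} {lam κ δ : ℝ}
    (hf : ∀ x y : E, ∀ t : ℝ, 0 ≤ t → t ≤ 1 →
      f (t • x + (1 - t) • y) ≤ t * f x + (1 - t) * f y - lam / 2 * (t * (1 - t)) * ‖x - y‖ ^ 2)
    (hκ : 0 ≤ κ) (hδ0 : 0 ≤ δ) (hδ1 : δ ≤ 1) {w z : E}
    (hprox : ∀ v, f w + κ / 2 * ‖w - z‖ ^ 2 ≤
      f v + κ / 2 * ‖v - z‖ ^ 2 + δ * κ / 2 * ‖w - z‖ ^ 2) (x : E) :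
    f w + (1 - δ) * (κ + lam) / 2 * ‖x - w‖ ^ 2 ≤ f x + κ / 2 * ‖x - z‖ ^ 2 := by
  have key (s : ℝ) (hs0 : 0 ≤ s) (hs1 : s ≤ 1) :
      s * (f w + κ / 2 * ‖w - z‖ ^ 2 + (1 - s) * (κ + lam) / 2 * ‖x - w‖ ^ 2) ≤
        s * (f x + κ / 2 * ‖x - z‖ ^ 2) + δ * κ / 2 * ‖w - z‖ ^ 2 := by
    have h1 := hprox (s • x + (1 - s) • w)
    have h2 := hf x w s hs0 hs1
    have h3 : s • x + (1 - s) • w - z = s • (x - z) + (1 - s) • (w - z) := by module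
    rw [h3, norm_smul_add_smul_sq, sub_sub_sub_cancel_right] at h1
    linear_combination h1 + h2
  rcases hδ0.eq_or_lt with rfl | hδ
  · have hlim : Filter.Tendsto (fun s : ℝ ↦
        f w + κ / 2 * ‖w - z‖ ^ 2 + (1 - s) * (κ + lam) / 2 * ‖x - w‖ ^ 2) (nhdsWithin 0 (Set.Ioi 0))
        (nhds (f w + κ / 2 * ‖w - z‖ ^ 2 + (1 - 0) * (κ + lam) / 2 * ‖x - w‖ ^ 2)) :=
      (Continuous.tendsto (by fun_prop) 0).mono_left nhdsWithin_le_nhds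
    have h := le_of_tendsto hlim (b := f x + κ / 2 * ‖x - z‖ ^ 2) <| by
      filter_upwards [Ioc_mem_nhdsGT (zero_lt_one' ℝ)] with s hs
      have := key s hs.1.le hs.2
      exact le_of_mul_le_mul_left (by linarith) hs.1
    have : 0 ≤ κ / 2 * ‖w - z‖ ^ 2 := by positivity
    linarith
  · exact le_of_mul_le_mul_left (by linear_combination key δ hδ0 hδ1) hδ

/-- One step of the inexact accelerated proximal point method contracts the estimate-sequence
potential. -/
lemma inexact_accelerated_prox_step {f : E → ℝ} {lam κ δ α η : ℝ}
    (hf : ∀ x y : E, ∀ t : ℝ, 0 ≤ t → t ≤ 1 →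
      f (t • x + (1 - t) • y) ≤ t * f x + (1 - t) * f y - lam / 2 * (t * (1 - t)) * ‖x - y‖ ^ 2)
    (hlam : 0 ≤ lam) (hκ : 0 < κ) (hδ0 : 0 ≤ δ) (hδ1 : δ ≤ 1) (hα0 : 0 ≤ α) (hα1 : α ≤ 1)
    (hη : κ * η = (κ + lam) * α - lam) (hη0 : 0 ≤ η) {w w' v v' z : E}
    (hz : z = w + η • (v - w)) (hw' : w' = α • v' + (1 - α) • w)
    (hprox : ∀ y, f w' + κ / 2 * ‖w' - z‖ ^ 2 ≤
      f y + κ / 2 * ‖y - z‖ ^ 2 + δ * κ / 2 * ‖w' - z‖ ^ 2) (x : E) :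
    f w' - f x + (1 - δ) * ((κ + lam) * α ^ 2 / 2) * ‖x - v'‖ ^ 2 ≤
      (1 - α) * (f w - f x) + ((κ + lam) * α ^ 2 - lam * α) / 2 * ‖x - v‖ ^ 2 := by
  have h1 := inexact_prox_three_point hf hκ.le hδ0 hδ1 hprox (α • x + (1 - α) • w)
  have h2 := hf x w α hα0 hα1
  have h3 : α • x + (1 - α) • w - w' = α • (x - v') := by rw [hw']; module
  have h4 : α • x + (1 - α) • w - z = η • (x - v) + (α - η) • (x - w) := by rw [hz]; module
  have hηα : η ≤ α := by
    refine le_of_mul_le_mul_left ?_ hκ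
    nlinarith
  have h5 : 0 ≤ κ / 2 * (η * (α - η) * ‖x - v - (x - w)‖ ^ 2) := by
    have := sub_nonneg.2 hηα
    positivity
  rw [h3, h4, norm_smul_add_smul_sq, norm_smul, mul_pow, Real.norm_eq_abs, sq_abs] at h1
  linear_combination h1 + h2 + h5 + (α / 2 * (‖x - v‖ ^ 2 - ‖x - w‖ ^ 2)) * hη

end InnerProductSpace

lemma extrapolation_coeff_bounds {lam : ℝ} (hlam : 0 ≤ lam) {κ α : ℕ → ℝ}
    (hκ : ∀ k, 1 ≤ k → 0 < κ k) (hα0pos : 0 < α 0) (hα0lt : α 0 < 1)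
    (hα0sq : lam / (lam + κ 1) ≤ α 0 ^ 2)
    (hαrec : ∀ k, 1 ≤ k → 0 ≤ α k ∧
      α k ^ 2 * (κ (k + 1) + lam) = (1 - α k) * α (k - 1) ^ 2 * (κ k + lam) + α k * lam) (k : ℕ) :
    0 < α k ∧ α k < 1 ∧ lam ≤ α k ^ 2 * (κ (k + 1) + lam) := by
  induction k with
  | zero =>
    have h1 := hκ 1 le_rfl
    rw [div_le_iff₀ (by positivity)] at hα0sq
    exact ⟨hα0pos, hα0lt, by rw [zero_add]; linarith⟩
  | succ n ih =>
    obtain ⟨hpos, -, hsq⟩ := ih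
    obtain ⟨h0, hrec⟩ := hαrec (n + 1) (by omega)
    rw [Nat.add_sub_cancel] at hrec
    have hκ1 := hκ (n + 1) (by omega)
    have hκ2 := hκ (n + 1 + 1) (by omega)
    have hA : 0 < α n ^ 2 * (κ (n + 1) + lam) := by positivity
    have hpos' : 0 < α (n + 1) := by
      refine h0.lt_of_ne fun h ↦ ?_
      rw [← h] at hrec
      linarith
    have hlt : α (n + 1) < 1 := by
      by_contra! h
      have h1 : 0 ≤ (α (n + 1) - 1) * (α n ^ 2 * (κ (n + 1) + lam)) :=
        mul_nonneg (by linarith) hA.le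
      have h2 : 0 ≤ (α (n + 1) - 1) * (α (n + 1) * lam) :=
        mul_nonneg (by linarith) (by positivity)
      have h3 : 0 < α (n + 1) ^ 2 * κ (n + 1 + 1) := by positivity
      linarith
    refine ⟨hpos', hlt, ?_⟩
    have := mul_nonneg (sub_nonneg.2 hlt.le) (sub_nonneg.2 hsq)
    linarith

/-- The closed form of the recursion
`(1 - δ (n + 1)) * U (n + 1) = (1 - α n) * U n + α n * m n`, where `U n = E n + m n`. -/
lemma damped_recursion_closed_form {α δ : ℕ → ℝ} (m : ℕ → ℝ) (Δ : ℝ) {n : ℕ}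
    (hδ : δ (n + 1) ≠ 1) {U : ℕ → ℝ}
    (hU : U = fun k ↦ ((∏ r ∈ Finset.range k, (1 - α r)) / ∏ r ∈ Finset.Icc 1 k, (1 - δ r)) * Δ +
      m k + ∑ j ∈ Finset.Icc 1 k,
        ((∏ r ∈ Finset.Icc j (k - 1), (1 - α r)) / ∏ r ∈ Finset.Icc j k, (1 - δ r)) *
          (m (j - 1) - (1 - δ j) * m j)) :
    (1 - δ (n + 1)) * U (n + 1) = (1 - α n) * U n + α n * m n := by
  have hne : 1 - δ (n + 1) ≠ 0 := sub_ne_zero.2 hδ.symm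
  have hsum : (1 - δ (n + 1)) * ∑ j ∈ Finset.Icc 1 n,
        ((∏ r ∈ Finset.Icc j n, (1 - α r)) / ∏ r ∈ Finset.Icc j (n + 1), (1 - δ r)) *
          (m (j - 1) - (1 - δ j) * m j) =
      (1 - α n) * ∑ j ∈ Finset.Icc 1 n,
        ((∏ r ∈ Finset.Icc j (n - 1), (1 - α r)) / ∏ r ∈ Finset.Icc j n, (1 - δ r)) *
          (m (j - 1) - (1 - δ j) * m j) := by
    rw [Finset.mul_sum, Finset.mul_sum]
    refine Finset.sum_congr rfl fun j hj ↦ ?_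
    obtain ⟨h1, h2⟩ := Finset.mem_Icc.1 hj
    obtain ⟨p, rfl⟩ : ∃ p, n = p + 1 := ⟨n - 1, by omega⟩
    rw [Finset.prod_Icc_succ_top (by omega : j ≤ p + 1 + 1),
      Finset.prod_Icc_succ_top h2 fun r ↦ 1 - α r, Nat.add_sub_cancel, ← div_div]
    field_simp
  rw [hU]
  simp only [Nat.add_sub_cancel]
  rw [Finset.sum_Icc_succ_top (by omega), Finset.prod_range_succ,
    Finset.prod_Icc_succ_top (by omega), Finset.Icc_eq_empty (by omega : ¬ n + 1 ≤ n),
    Finset.Icc_self, Finset.prod_empty, Finset.prod_singleton, Nat.add_sub_cancel, mul_add, mul_add,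
    mul_add (1 - δ (n + 1)), hsum, ← div_div]
  field_simp
  ring

/-- Convergence of the abstract Casimir algorithm (Theorem 5.1 of the paper).
`G μ` is the `μ`-smoothed objective (λ-strongly convex, sandwiched within `(μ − μ')·D` of
`G μ'`), `F = G 0`, `wstar` a minimizer of `F`.  The iterates `(w k, z k, α k)` satisfy the
approximate proximal-point condition, the extrapolation recursion and the update of `z`. -/
theorem casimir_convergence
    {d : ℕ} (lam D : ℝ) (hlam : 0 ≤ lam) (hD : 0 ≤ D)
    (G : ℝ → EuclideanSpace ℝ (Fin d) → ℝ)
    -- each `G μ` is λ-strongly convex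
    (hSC : ∀ μ : ℝ, 0 ≤ μ → ∀ x y : EuclideanSpace ℝ (Fin d), ∀ t : ℝ, 0 ≤ t → t ≤ 1 →
      G μ (t • x + (1 - t) • y) ≤
        t * G μ x + (1 - t) * G μ y - lam / 2 * (t * (1 - t)) * ‖x - y‖ ^ 2)
    -- sandwich property of the smoothing
    (hsandwich : ∀ μ μ' : ℝ, 0 ≤ μ' → μ' ≤ μ → ∀ w : EuclideanSpace ℝ (Fin d),
      0 ≤ G μ w - G μ' w ∧ G μ w - G μ' w ≤ (μ - μ') * D)
    -- `wstar` minimizes `F = G 0`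
    (wstar : EuclideanSpace ℝ (Fin d)) (hstar : ∀ w, G 0 wstar ≤ G 0 w)
    -- parameter sequences
    (μseq κseq δseq : ℕ → ℝ)
    (hμnn : ∀ k, 1 ≤ k → 0 ≤ μseq k) (hμdec : ∀ k, 1 ≤ k → μseq (k + 1) ≤ μseq k)
    (hκpos : ∀ k, 1 ≤ k → 0 < κseq k) (hκinc : ∀ k, 1 ≤ k → κseq k ≤ κseq (k + 1))
    (hδ : ∀ k, 1 ≤ k → 0 ≤ δseq k ∧ δseq k < 1)
    -- iterates
    (w z : ℕ → EuclideanSpace ℝ (Fin d)) (α : ℕ → ℝ)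
    (hα0pos : 0 < α 0) (hα0lt : α 0 < 1) (hα0sq : lam / (lam + κseq 1) ≤ α 0 ^ 2)
    (hz0 : z 0 = w 0)
    -- (a) approximate proximal point step
    (hprox : ∀ k, 1 ≤ k → ∀ v : EuclideanSpace ℝ (Fin d),
      G (μseq k) (w k) + κseq k / 2 * ‖w k - z (k - 1)‖ ^ 2 ≤
        G (μseq k) v + κseq k / 2 * ‖v - z (k - 1)‖ ^ 2 +
          δseq k * κseq k / 2 * ‖w k - z (k - 1)‖ ^ 2)
    -- (b) extrapolation coefficient recursion
    (hαrec : ∀ k, 1 ≤ k → 0 ≤ α k ∧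
      α k ^ 2 * (κseq (k + 1) + lam) =
        (1 - α k) * α (k - 1) ^ 2 * (κseq k + lam) + α k * lam)
    -- (c) extrapolation step
    (hzrec : ∀ k, 1 ≤ k → z k = w k +
      (α (k - 1) * (1 - α (k - 1)) * (κseq k + lam) /
        (α (k - 1) ^ 2 * (κseq k + lam) + α k * (κseq (k + 1) + lam))) • (w k - w (k - 1))) :
    ∀ k, 1 ≤ k →
      G 0 (w k) - G 0 wstar ≤
        ((∏ r ∈ Finset.range k, (1 - α r)) / ∏ r ∈ Finset.Icc 1 k, (1 - δseq r)) *
            (G 0 (w 0) - G 0 wstar +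
              ((κseq 1 + lam) * α 0 ^ 2 - lam * α 0) / (2 * (1 - α 0)) *
                ‖w 0 - wstar‖ ^ 2) +
          μseq k * D +
          ∑ j ∈ Finset.Icc 1 k,
            ((∏ r ∈ Finset.Icc j (k - 1), (1 - α r)) / ∏ r ∈ Finset.Icc j k, (1 - δseq r)) *
              ((if j = 1 then 2 * μseq 1 else μseq (j - 1)) - (1 - δseq j) * μseq j) * D := by
  have hα := extrapolation_coeff_bounds hlam hκpos hα0pos hα0lt hα0sq hαrec
  let v : ℕ → EuclideanSpace ℝ (Fin d)
    | 0 => w 0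
    | n + 1 => w n + (α n)⁻¹ • (w (n + 1) - w n)
  let C : ℕ → ℝ := fun n ↦ ((κseq (n + 1) + lam) * α n ^ 2 - lam * α n) / (2 * (1 - α n))
  let η : ℕ → ℝ := fun n ↦ ((κseq (n + 1) + lam) * α n - lam) / κseq (n + 1)
  have hv (n : ℕ) : w (n + 1) = α n • v (n + 1) + (1 - α n) • w n := by
    have := (hα n).1.ne'
    change _ = α n • (w n + (α n)⁻¹ • (w (n + 1) - w n)) + _
    rw [smul_add, smul_inv_smul₀ this]
    module
  have hη (n : ℕ) : κseq (n + 1) * η n = (κseq (n + 1) + lam) * α n - lam :=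
    mul_div_cancel₀ _ (hκpos (n + 1) (by omega)).ne'
  have hη0 (n : ℕ) : 0 ≤ η n := by
    obtain ⟨h0, h1, h2⟩ := hα n
    have hκ := hκpos (n + 1) (by omega)
    refine div_nonneg ?_ hκ.le
    have : 0 ≤ α n * (1 - α n) * (κseq (n + 1) + lam) :=
      mul_nonneg (mul_nonneg h0.le (by linarith)) (by linarith)
    linarith
  have hC (n : ℕ) : C (n + 1) = (κseq (n + 1) + lam) * α n ^ 2 / 2 := by
    have h1 : 1 - α (n + 1) ≠ 0 := (sub_pos.2 (hα (n + 1)).2.1).ne'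
    have h2 := (hαrec (n + 1) (by omega)).2
    rw [Nat.add_sub_cancel] at h2
    change _ / (2 * (1 - α (n + 1))) = _
    rw [div_eq_div_iff (by simpa using h1) two_ne_zero]
    linear_combination 2 * h2
  have hz (n : ℕ) : z n = w n + η n • (v n - w n) := by
    cases n with
    | zero => simp [v, hz0]
    | succ n =>
      have h1 := (hα n).1
      have h2 := (hα (n + 1)).1
      have hκ1 := hκpos (n + 1) (by omega)
      have hκ2 := hκpos (n + 1 + 1) (by omega)
      have h3 := (hαrec (n + 1) (by omega)).2
      have h4 : v (n + 1) - w (n + 1) = ((α n)⁻¹ - 1) • (w (n + 1) - w n) := by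
        change w n + (α n)⁻¹ • (w (n + 1) - w n) - w (n + 1) = _
        module
      rw [hzrec (n + 1) (by omega), h4, smul_smul]
      rw [Nat.add_sub_cancel] at h3 ⊢
      congr 2
      have h5 : η (n + 1) = α n ^ 2 * (κseq (n + 1) + lam) /
          (α n ^ 2 * (κseq (n + 1) + lam) + α (n + 1) * (κseq (n + 1 + 1) + lam)) := by
        rw [eq_div_iff (by positivity)]
        refine mul_left_cancel₀ hκ2.ne' ?_
        rw [← mul_assoc, hη]
        linear_combination (κseq (n + 1 + 1) + lam) * h3
      rw [h5, div_mul_eq_mul_div]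
      congr 1
      field_simp
  have hstep (n : ℕ) : (1 - δseq (n + 1)) *
        (G (μseq (n + 1)) (w (n + 1)) - G 0 wstar + C (n + 1) * ‖wstar - v (n + 1)‖ ^ 2) ≤
      (1 - α n) * (G (μseq (n + 1)) (w n) - G 0 wstar + C n * ‖wstar - v n‖ ^ 2) +
        α n * (μseq (n + 1) * D) := by
    obtain ⟨h0, h1, -⟩ := hα n
    have hn : 1 ≤ n + 1 := by omega
    have hμ := hμnn (n + 1) hn
    have hprox' := hprox (n + 1) hn
    rw [Nat.add_sub_cancel] at hprox'
    have h2 := inexact_accelerated_prox_step (hSC _ hμ) hlam (hκpos _ hn) (hδ _ hn).1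
      (hδ _ hn).2.le h0.le h1.le (hη n) (hη0 n) (hz n) (hv n) hprox' wstar
    have h3 : (1 - α n) * C n = ((κseq (n + 1) + lam) * α n ^ 2 - lam * α n) / 2 := by
      have : 1 - α n ≠ 0 := (sub_pos.2 h1).ne'
      simp only [C]
      field_simp
    have h4 := mul_le_mul_of_nonneg_left (hsandwich _ 0 le_rfl hμ wstar).2 h0.le
    have h5 : 0 ≤ δseq (n + 1) * (G (μseq (n + 1)) (w (n + 1)) - G 0 wstar) :=
      mul_nonneg (hδ _ hn).1
        (by linarith [(hsandwich _ 0 le_rfl hμ (w (n + 1))).1, hstar (w (n + 1))])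
    rw [← hC, ← h3] at h2
    linear_combination h2 + h4 + h5
  let m : ℕ → ℝ := fun n ↦ (if n = 0 then 2 * μseq 1 else μseq n) * D
  have hm (n : ℕ) : μseq (n + 1) * D ≤ m n := by
    refine mul_le_mul_of_nonneg_right ?_ hD
    split_ifs with h
    · subst h
      linarith [hμnn 1 le_rfl]
    · exact hμdec n (by omega)
  let Δ : ℝ := G 0 (w 0) - G 0 wstar +
    ((κseq 1 + lam) * α 0 ^ 2 - lam * α 0) / (2 * (1 - α 0)) * ‖w 0 - wstar‖ ^ 2
  obtain ⟨U, hU⟩ : ∃ U : ℕ → ℝ, U = fun k ↦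
      ((∏ r ∈ Finset.range k, (1 - α r)) / ∏ r ∈ Finset.Icc 1 k, (1 - δseq r)) * Δ +
      m k + ∑ j ∈ Finset.Icc 1 k,
        ((∏ r ∈ Finset.Icc j (k - 1), (1 - α r)) / ∏ r ∈ Finset.Icc j k, (1 - δseq r)) *
          (m (j - 1) - (1 - δseq j) * m j) := ⟨_, rfl⟩
  have hbound (n : ℕ) :
      G (μseq (n + 1)) (w n) - G 0 wstar + C n * ‖wstar - v n‖ ^ 2 ≤ U n ∧
      G (μseq (n + 1)) (w (n + 1)) - G 0 wstar + C (n + 1) * ‖wstar - v (n + 1)‖ ^ 2 ≤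
        U (n + 1) := by
    have hnext (n : ℕ)
        (h : G (μseq (n + 1)) (w n) - G 0 wstar + C n * ‖wstar - v n‖ ^ 2 ≤ U n) :
        G (μseq (n + 1)) (w (n + 1)) - G 0 wstar + C (n + 1) * ‖wstar - v (n + 1)‖ ^ 2 ≤
          U (n + 1) := by
      obtain ⟨h0, h1, -⟩ := hα n
      have hδn := (hδ (n + 1) (by omega)).2
      refine le_of_mul_le_mul_left ?_ (sub_pos.2 hδn)
      rw [damped_recursion_closed_form m Δ hδn.ne hU]
      exact (hstep n).trans (add_le_add (mul_le_mul_of_nonneg_left h (by linarith))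
        (mul_le_mul_of_nonneg_left (hm n) h0.le))
    induction n with
    | zero =>
      refine ⟨?_, hnext 0 ?_⟩ <;>
      · have h1 := (hsandwich _ 0 le_rfl (hμnn 1 le_rfl) (w 0)).2
        have h2 := hm 0
        simp only [hU, v, C, Δ, norm_sub_rev wstar]
        simp
        linarith
    | succ n ih =>
      have h : G (μseq (n + 1 + 1)) (w (n + 1)) - G 0 wstar +
          C (n + 1) * ‖wstar - v (n + 1)‖ ^ 2 ≤ U (n + 1) := by
        have := (hsandwich _ _ (hμnn (n + 1 + 1) (by omega)) (hμdec (n + 1) (by omega))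
          (w (n + 1))).1
        linarith [ih.2]
      exact ⟨h, hnext (n + 1) h⟩
  intro k hk
  obtain ⟨n, rfl⟩ : ∃ n, k = n + 1 := ⟨k - 1, by omega⟩
  have hCnn : 0 ≤ C (n + 1) * ‖wstar - v (n + 1)‖ ^ 2 := by
    have := hκpos (n + 1) hk
    rw [hC]
    positivity
  have hle : G 0 (w (n + 1)) - G 0 wstar ≤ U (n + 1) := by
    linarith [(hbound n).2, (hsandwich _ 0 le_rfl (hμnn (n + 1) hk) (w (n + 1))).1]
  refine hle.trans_eq ?_
  rw [hU]
  refine congrArg₂ (· + ·) (by simp [m, Δ]) (Finset.sum_congr rfl fun j hj ↦ ?_)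
  have hj1 := (Finset.mem_Icc.1 hj).1
  have h1 : (j - 1 = 0) ↔ j = 1 := by omega
  have h2 : j ≠ 0 := by omega
  simp only [m, h1, h2, if_false]
  split_ifs <;> ring
end

section
/- In the abstract Casimir setting, suppose in addition that λ > 0, and that for some constants μ ≥ 0 and κ > 0 the parameters are μ_k = μ and κ_k = κ for all k ≥ 1, α₀ = √q and δ_k = √q / (2 − √q) for all k ≥ 1, where q = λ/(λ + κ). Then for every k ≥ 1, F(w_k) − F* ≤ ( (3 − √q)/(1 − √q) ) · μ D + 2 (1 − √q/2)^k · ( F(w₀) − F* ). -/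
/-- The squared norm of an affine combination of two vectors. -/
theorem norm_sq_affine_combination {E : Type*} [NormedAddCommGroup E] [InnerProductSpace ℝ E]
    (a b : E) (t : ℝ) :
    ‖t • a + (1 - t) • b‖ ^ 2 = t * ‖a‖ ^ 2 + (1 - t) * ‖b‖ ^ 2 - t * (1 - t) * ‖a - b‖ ^ 2 := by
  rw [norm_add_sq_real, norm_sub_sq_real, norm_smul, norm_smul, mul_pow, mul_pow,
    inner_smul_left, inner_smul_right, Real.norm_eq_abs, Real.norm_eq_abs, sq_abs, sq_abs]
  simp only [conj_trivial]
  ring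

/-- The function `f` is strongly convex with modulus `lam`. -/
def IsStronglyConvex {E : Type*} [NormedAddCommGroup E] [InnerProductSpace ℝ E]
    (lam : ℝ) (f : E → ℝ) : Prop :=
  ∀ x y : E, ∀ t : ℝ, 0 ≤ t → t ≤ 1 →
    f (t • x + (1 - t) • y) ≤
      t * f x + (1 - t) * f y - lam / 2 * (t * (1 - t)) * ‖x - y‖ ^ 2

/-- A strongly convex function grows quadratically around its minimizer. -/
theorem IsStronglyConvex.quadratic_growth {E : Type*} [NormedAddCommGroup E]
    [InnerProductSpace ℝ E] {lam : ℝ} {f : E → ℝ} (hf : IsStronglyConvex lam f) {xs : E}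
    (hmin : ∀ x, f xs ≤ f x) (x : E) :
    lam / 2 * ‖x - xs‖ ^ 2 ≤ f x - f xs := by
  by_contra! hlt
  have hgap := hmin x
  set N := lam / 2 * ‖x - xs‖ ^ 2 with hN
  have hNpos : 0 < N := by linarith
  set t := (N - (f x - f xs)) / (2 * N) with ht
  have htN : t * (2 * N) = N - (f x - f xs) := by
    rw [ht]
    field_simp
  have ht0 : 0 < t := div_pos (by linarith) (by linarith)
  have ht1 : t ≤ 1 := (div_le_one (by linarith)).2 (by linarith)
  have h1 := hf x xs t ht0.le ht1
  have h2 := hmin (t • x + (1 - t) • xs)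
  have h3 : t * ((1 - t) * N) ≤ t * (f x - f xs) := by
    rw [hN]
    linarith
  have h4 := le_of_mul_le_mul_left h3 ht0
  linarith

/-- A point solving a proximal problem up to the relative accuracy `δ` satisfies a three-point
inequality. -/
theorem IsStronglyConvex.three_point_of_approx_prox {E : Type*} [NormedAddCommGroup E]
    [InnerProductSpace ℝ E] {lam κ δ : ℝ} {f : E → ℝ} (hf : IsStronglyConvex lam f) {y z : E}
    (hδ0 : 0 < δ) (hδ1 : δ ≤ 1)
    (hprox : ∀ v, f y + κ / 2 * ‖y - z‖ ^ 2 ≤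
      f v + κ / 2 * ‖v - z‖ ^ 2 + δ * κ / 2 * ‖y - z‖ ^ 2) (x : E) :
    f y + (lam + κ) / 2 * (1 - δ) * ‖x - y‖ ^ 2 ≤ f x + κ / 2 * ‖x - z‖ ^ 2 := by
  have h1 := hprox (δ • x + (1 - δ) • y)
  have h2 := hf x y δ hδ0.le hδ1
  have h3 : δ • x + (1 - δ) • y - z = δ • (x - z) + (1 - δ) • (y - z) := by module
  rw [h3, norm_sq_affine_combination, sub_sub_sub_cancel_right] at h1
  refine le_of_mul_le_mul_left ?_ hδ0
  linarith

/-- One step of the accelerated inexact proximal point method, where `v` and `v'` are the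
auxiliary points attached to the successive iterates `x` and `y`. -/
theorem IsStronglyConvex.accelerated_step {E : Type*} [NormedAddCommGroup E]
    [InnerProductSpace ℝ E] {lam κ s : ℝ} {f : E → ℝ} (hf : IsStronglyConvex lam f)
    (hs0 : 0 < s) (hs1 : s < 1) (hκ : 0 ≤ κ) (hs : s ^ 2 * (lam + κ) = lam) {x y z v v' : E}
    (hprox : ∀ u, f y + κ / 2 * ‖y - z‖ ^ 2 ≤
      f u + κ / 2 * ‖u - z‖ ^ 2 + s / (2 - s) * κ / 2 * ‖y - z‖ ^ 2)
    (hz : (1 + s) • z = x + s • v) (hv' : s • v' = y - (1 - s) • x) (xs : E) :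
    f y - f xs + lam / 2 * ((1 - s) / (1 - s / 2)) * ‖xs - v'‖ ^ 2 ≤
      (1 - s) * (f x - f xs) + lam / 2 * (1 - s) * ‖xs - v‖ ^ 2 := by
  have hδ0 : 0 < s / (2 - s) := div_pos hs0 (by linarith)
  have hδ1 : s / (2 - s) ≤ 1 := (div_le_one (by linarith)).2 (by linarith)
  have h1 := hf.three_point_of_approx_prox hδ0 hδ1 hprox (s • xs + (1 - s) • x)
  have h2 := hf xs x s hs0.le hs1.le
  have hδ : 1 - s / (2 - s) = (1 - s) / (1 - s / 2) := by
    have : 2 - s ≠ 0 := by linarith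
    have : 1 - s / 2 ≠ 0 := by linarith
    field_simp
    ring
  have e1 : s • xs + (1 - s) • x - y = s • (xs - v') := by
    rw [smul_sub, hv']
    module
  have n1 : ‖s • xs + (1 - s) • x - y‖ ^ 2 = s ^ 2 * ‖xs - v'‖ ^ 2 := by
    rw [e1, norm_smul, mul_pow, Real.norm_eq_abs, sq_abs]
  have e2 : (1 + s) • (s • xs + (1 - s) • x - z) =
      ((1 + s) * s) • ((s / (1 + s)) • (xs - x) + (1 - s / (1 + s)) • (xs - v)) := by
    have c1 : (1 + s) * s * (s / (1 + s)) = s ^ 2 := by field_simp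
    have c2 : (1 + s) * s * (1 - s / (1 + s)) = s := by field_simp; ring
    rw [smul_add ((1 + s) * s), smul_smul, smul_smul, c1, c2, smul_sub (1 + s), hz]
    module
  have e3 : s • xs + (1 - s) • x - z =
      s • ((s / (1 + s)) • (xs - x) + (1 - s / (1 + s)) • (xs - v)) := by
    rw [mul_smul] at e2
    exact smul_right_injective E (by linarith : (1 + s) ≠ 0) e2
  have n2 : (1 + s) * ‖s • xs + (1 - s) • x - z‖ ^ 2 ≤
      s ^ 2 * (s * ‖xs - x‖ ^ 2 + ‖xs - v‖ ^ 2) := by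
    rw [e3, norm_smul, mul_pow, Real.norm_eq_abs, sq_abs, norm_sq_affine_combination]
    have hr0 : 0 ≤ s / (1 + s) := by positivity
    have hr1 : 1 - s / (1 + s) = 1 / (1 + s) := by field_simp; ring
    rw [hr1]
    have : (1 + s) * (s ^ 2 * (s / (1 + s) * ‖xs - x‖ ^ 2 + 1 / (1 + s) * ‖xs - v‖ ^ 2 -
        s / (1 + s) * (1 / (1 + s)) * ‖xs - x - (xs - v)‖ ^ 2)) =
        s ^ 2 * (s * ‖xs - x‖ ^ 2 + ‖xs - v‖ ^ 2) -
          s ^ 3 / (1 + s) * ‖xs - x - (xs - v)‖ ^ 2 := by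
      field_simp
    rw [this]
    have : 0 ≤ s ^ 3 / (1 + s) * ‖xs - x - (xs - v)‖ ^ 2 := by positivity
    linarith
  have hκs : κ * s ^ 2 = lam * (1 - s) * (1 + s) := by linear_combination hs
  have n3 : κ / 2 * ‖s • xs + (1 - s) • x - z‖ ^ 2 ≤
      lam / 2 * (1 - s) * (s * ‖xs - x‖ ^ 2 + ‖xs - v‖ ^ 2) := by
    have h := mul_le_mul_of_nonneg_left n2 (by linarith : 0 ≤ κ / 2)
    refine le_of_mul_le_mul_left ?_ (by linarith : 0 < 1 + s)
    linear_combination h + (s * ‖xs - x‖ ^ 2 + ‖xs - v‖ ^ 2) / 2 * hκs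
  rw [n1, hδ] at h1
  have h3 : (lam + κ) / 2 * ((1 - s) / (1 - s / 2)) * (s ^ 2 * ‖xs - v'‖ ^ 2) =
      lam / 2 * ((1 - s) / (1 - s / 2)) * ‖xs - v'‖ ^ 2 := by
    linear_combination ((1 - s) / (1 - s / 2)) * ‖xs - v'‖ ^ 2 / 2 * hs
  linarith


/-- Casimir convergence with constant smoothing in the strongly convex case
(Corollary 5.2 of the paper): with `q = λ/(λ+κ)`, constant parameters `μ_k = μ`,
`κ_k = κ`, `α₀ = √q` and `δ_k = √q/(2 − √q)`, one has
`F(w_k) − F* ≤ ((3−√q)/(1−√q)) μ D + 2 (1 − √q/2)^k (F(w₀) − F*)`. -/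
theorem casimir_strongly_convex_constant_smoothing
    {d : ℕ} (lam D : ℝ) (hlam : 0 < lam) (hD : 0 ≤ D)
    (G : ℝ → EuclideanSpace ℝ (Fin d) → ℝ)
    -- each `G ν` is λ-strongly convex
    (hSC : ∀ ν : ℝ, 0 ≤ ν → ∀ x y : EuclideanSpace ℝ (Fin d), ∀ t : ℝ, 0 ≤ t → t ≤ 1 →
      G ν (t • x + (1 - t) • y) ≤
        t * G ν x + (1 - t) * G ν y - lam / 2 * (t * (1 - t)) * ‖x - y‖ ^ 2)
    -- sandwich property of the smoothing
    (hsandwich : ∀ ν ν' : ℝ, 0 ≤ ν' → ν' ≤ ν → ∀ w : EuclideanSpace ℝ (Fin d),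
      0 ≤ G ν w - G ν' w ∧ G ν w - G ν' w ≤ (ν - ν') * D)
    -- `wstar` minimizes `F = G 0`
    (wstar : EuclideanSpace ℝ (Fin d)) (hstar : ∀ w, G 0 wstar ≤ G 0 w)
    -- constant parameters
    (μ κ : ℝ) (hμ : 0 ≤ μ) (hκ : 0 < κ)
    (q : ℝ) (hq : q = lam / (lam + κ))
    -- iterates
    (w z : ℕ → EuclideanSpace ℝ (Fin d)) (α : ℕ → ℝ)
    (hα0 : α 0 = Real.sqrt q)
    (hz0 : z 0 = w 0)
    -- (a) approximate proximal point step with `δ_k = √q/(2 − √q)`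
    (hprox : ∀ k, 1 ≤ k → ∀ v : EuclideanSpace ℝ (Fin d),
      G μ (w k) + κ / 2 * ‖w k - z (k - 1)‖ ^ 2 ≤
        G μ v + κ / 2 * ‖v - z (k - 1)‖ ^ 2 +
          (Real.sqrt q / (2 - Real.sqrt q)) * κ / 2 * ‖w k - z (k - 1)‖ ^ 2)
    -- (b) extrapolation coefficient recursion
    (hαrec : ∀ k, 1 ≤ k → 0 ≤ α k ∧
      α k ^ 2 * (κ + lam) = (1 - α k) * α (k - 1) ^ 2 * (κ + lam) + α k * lam)
    -- (c) extrapolation step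
    (hzrec : ∀ k, 1 ≤ k → z k = w k +
      (α (k - 1) * (1 - α (k - 1)) * (κ + lam) /
        (α (k - 1) ^ 2 * (κ + lam) + α k * (κ + lam))) • (w k - w (k - 1))) :
    ∀ k, 1 ≤ k →
      G 0 (w k) - G 0 wstar ≤
        (3 - Real.sqrt q) / (1 - Real.sqrt q) * (μ * D) +
          2 * (1 - Real.sqrt q / 2) ^ k * (G 0 (w 0) - G 0 wstar) := by
  obtain ⟨s, hs⟩ : ∃ s, s = Real.sqrt q := ⟨_, rfl⟩
  simp only [← hs] at hα0 hprox ⊢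
  have hq0 : 0 < q := hq ▸ div_pos hlam (by linarith)
  have hq1 : q < 1 := by
    rw [hq, div_lt_one (by linarith)]
    linarith
  have hs0 : 0 < s := hs ▸ Real.sqrt_pos.2 hq0
  have hsq : s ^ 2 = q := by rw [hs, Real.sq_sqrt hq0.le]
  have hs1 : s < 1 := by nlinarith
  have hsl : s ^ 2 * (lam + κ) = lam := by
    rw [hsq, hq]
    field_simp
  have hα : ∀ k, α k = s := by
    intro k
    induction k with
    | zero => exact hα0
    | succ k ih =>
      obtain ⟨h0, h1⟩ := hαrec (k + 1) (by omega)
      rw [Nat.add_sub_cancel, ih] at h1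
      have h2 : (α (k + 1) ^ 2 - s ^ 2) * (κ + lam) = 0 := by
        linear_combination h1 - α (k + 1) * hsl
      have h3 : α (k + 1) ^ 2 = s ^ 2 := by
        rcases mul_eq_zero.1 h2 with h | h <;> linarith
      exact (sq_eq_sq₀ h0 hs0.le).1 h3
  obtain ⟨v, hv⟩ : ∃ v : ℕ → EuclideanSpace ℝ (Fin d),
      ∀ k, s • v k = w k - (1 - s) • w (k - 1) :=
    ⟨fun k ↦ s⁻¹ • (w k - (1 - s) • w (k - 1)), fun k ↦ smul_inv_smul₀ hs0.ne' _⟩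
  have hz : ∀ k, (1 + s) • z k = w k + s • v k := by
    intro k
    rw [hv]
    rcases Nat.eq_zero_or_pos k with rfl | hk
    · rw [hz0, Nat.zero_sub]
      module
    · have hβ : (1 + s) * (s * (1 - s) * (κ + lam) / (s ^ 2 * (κ + lam) + s * (κ + lam))) =
          1 - s := by
        have : κ + lam ≠ 0 := by linarith
        have : s ^ 2 * (κ + lam) + s * (κ + lam) ≠ 0 := by positivity
        field_simp
        ring
      rw [hzrec k hk, hα, hα, smul_add, smul_smul, hβ]
      module
  have hv0 : v 0 = w 0 := by
    refine smul_right_injective _ hs0.ne' ?_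
    simp only [hv, Nat.zero_sub]
    module
  have hμD : 0 ≤ μ * D := mul_nonneg hμ hD
  have hsand : ∀ x, 0 ≤ G μ x - G 0 x ∧ G μ x - G 0 x ≤ μ * D := fun x ↦ by
    simpa using hsandwich μ 0 le_rfl hμ x
  have hSC0 : IsStronglyConvex lam (G 0) := hSC 0 le_rfl
  have hSCμ : IsStronglyConvex lam (G μ) := hSC μ hμ
  set c := (1 - s) / (1 - s / 2) with hc
  have hc0 : 0 ≤ c := div_nonneg (by linarith) (by linarith)
  have hc1 : c ≤ 1 := (div_le_one (by linarith)).2 (by linarith)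
  have hcs : (1 - s / 2) * c = 1 - s := mul_div_cancel₀ _ (by linarith)
  have key : ∀ k, G μ (w k) - G μ wstar + lam / 2 * c * ‖wstar - v k‖ ^ 2 ≤
      μ * D + 2 * (1 - s / 2) ^ k * (G 0 (w 0) - G 0 wstar) := by
    intro k
    induction k with
    | zero =>
      have h1 := hSC0.quadratic_growth hstar (w 0)
      rw [norm_sub_rev] at h1
      have h2 : lam / 2 * c * ‖wstar - w 0‖ ^ 2 ≤ lam / 2 * ‖wstar - w 0‖ ^ 2 := by
        gcongr
        exact mul_le_of_le_one_right (by linarith) hc1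
      rw [hv0]
      linarith [(hsand (w 0)).2, (hsand wstar).1]
    | succ k ih =>
      have h1 := hSCμ.accelerated_step hs0 hs1 hκ.le hsl (hprox (k + 1) (by omega)) (hz k)
        (hv (k + 1)) wstar
      rw [← hc] at h1
      have h2 := mul_le_mul_of_nonneg_left ih (by linarith : 0 ≤ 1 - s / 2)
      have h3 : -(μ * D) ≤ G μ (w k) - G μ wstar := by
        linarith [(hsand (w k)).1, (hsand wstar).2, hstar (w k)]
      have h4 := mul_le_mul_of_nonneg_left h3 (by linarith : 0 ≤ s / 2)
      rw [pow_succ]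
      linear_combination h1 + h2 + h4 - lam / 2 * ‖wstar - v k‖ ^ 2 * hcs
  intro k _
  have h1 : 2 * (μ * D) ≤ (3 - s) / (1 - s) * (μ * D) := by
    refine mul_le_mul_of_nonneg_right ?_ hμD
    rw [le_div_iff₀ (by linarith)]
    linarith
  have h2 : 0 ≤ lam / 2 * c * ‖wstar - v k‖ ^ 2 := by positivity
  linarith [key k, (hsand (w k)).1, (hsand wstar).2]
end

section
/- In the abstract Casimir setting, suppose in addition that λ = 0, and that for some constants μ ≥ 0 and κ > 0 the parameters are μ_k = μ and κ_k = κ for all k ≥ 1, α₀ = (√5 − 1)/2, and δ_k = 1/(k+1)² for all k ≥ 1. Then for every k ≥ 1, F(w_k) − F* ≤ (8/(k+2)²) · ( F(w₀) − F* + (κ/2)‖w₀ − w*‖₂² ) + μ D · ( 1 + 12/(k+2) + 30/(k+2)² ). -/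
/-- The three-point equality for the squared norm of a convex combination. -/
lemma norm_sq_convex_combination {E : Type*} [NormedAddCommGroup E] [InnerProductSpace ℝ E]
    (x y : E) (s : ℝ) :
    ‖s • x + (1 - s) • y‖ ^ 2 =
      s * ‖x‖ ^ 2 + (1 - s) * ‖y‖ ^ 2 - s * (1 - s) * ‖x - y‖ ^ 2 := by
  rw [norm_add_sq_real, norm_sub_sq_real, norm_smul, norm_smul, inner_smul_left,
    inner_smul_right, mul_pow, mul_pow, Real.norm_eq_abs, Real.norm_eq_abs, sq_abs, sq_abs]
  simp only [conj_trivial]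
  ring

/-- A proximal step of a convex function computed with relative accuracy `s` satisfies the exact
proximal inequality with strong convexity constant damped by `1 - s`. -/
lemma le_of_relative_inexact_prox {E : Type*} [NormedAddCommGroup E] [InnerProductSpace ℝ E]
    {f : E → ℝ} {κ s : ℝ} {p z : E}
    (hf : ∀ x y : E, ∀ t : ℝ, 0 ≤ t → t ≤ 1 →
      f (t • x + (1 - t) • y) ≤ t * f x + (1 - t) * f y)
    (hs : 0 < s) (hs1 : s ≤ 1)
    (hp : ∀ v : E, f p + κ / 2 * ‖p - z‖ ^ 2 ≤
      f v + κ / 2 * ‖v - z‖ ^ 2 + s * κ / 2 * ‖p - z‖ ^ 2) (v : E) :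
    f p ≤ f v + κ / 2 * ‖v - z‖ ^ 2 - (1 - s) * (κ / 2 * ‖v - p‖ ^ 2) := by
  have h1 := hp (s • v + (1 - s) • p)
  have h2 := hf v p s hs.le hs1
  have h3 := norm_sq_convex_combination (v - z) (p - z) s
  rw [show s • (v - z) + (1 - s) • (p - z) = s • v + (1 - s) • p - z by module,
    sub_sub_sub_cancel_right] at h3
  rw [h3] at h1
  refine le_of_mul_le_mul_left ?_ hs
  linear_combination h1 + h2

/-- Bounds for the coefficients `α (k + 1) ^ 2 = (1 - α (k + 1)) * α k ^ 2` started at the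
inverse golden ratio. -/
lemma extrapolation_coefficient_bounds {α : ℕ → ℝ} (hα0 : α 0 = (Real.sqrt 5 - 1) / 2)
    (hα : ∀ k, 0 ≤ α (k + 1) ∧ α (k + 1) ^ 2 = (1 - α (k + 1)) * α k ^ 2) (k : ℕ) :
    0 < α k ∧ α k * (k + 3) ≤ 2 ∧ 1 ≤ α k * (k + 2) := by
  induction k with
  | zero =>
    have h5 : Real.sqrt 5 ^ 2 = 5 := Real.sq_sqrt (by norm_num)
    have h0 := Real.sqrt_nonneg 5
    rw [hα0]
    push_cast
    refine ⟨?_, ?_, ?_⟩ <;> nlinarith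
  | succ k ih =>
    obtain ⟨ha, hup, hlow⟩ := ih
    obtain ⟨hb0, hrec⟩ := hα k
    have hb : 0 < α (k + 1) := by
      refine hb0.lt_of_ne fun h => ?_
      rw [← h] at hrec
      nlinarith
    have hinv : ((α (k + 1))⁻¹) ^ 2 = (α (k + 1))⁻¹ + ((α k)⁻¹) ^ 2 := by
      field_simp
      linarith
    have hk : (0 : ℝ) ≤ k := k.cast_nonneg
    have hup' : ((k : ℝ) + 3) / 2 ≤ (α k)⁻¹ := by
      rw [div_le_iff₀ two_pos, ← div_eq_inv_mul, le_div_iff₀ ha]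
      linarith
    have hlow' : (α k)⁻¹ ≤ k + 2 := by
      rw [inv_le_iff_one_le_mul₀ ha]
      linarith
    have hu : 0 < (α (k + 1))⁻¹ := inv_pos.2 hb
    have hu1 : ((k : ℝ) + 1 + 3) / 2 ≤ (α (k + 1))⁻¹ := by
      by_contra! hlt
      nlinarith
    have hu2 : (α (k + 1))⁻¹ ≤ k + 1 + 2 := by
      by_contra! hlt
      nlinarith
    push_cast
    refine ⟨hb, ?_, ?_⟩
    · rw [div_le_iff₀ two_pos, ← div_eq_inv_mul, le_div_iff₀ hb] at hu1
      linarith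
    · rw [inv_le_iff_one_le_mul₀ hb] at hu2
      linarith

/-- One step of the potential-function recursion: the damping factor `1 - 1 / (k + 2) ^ 2` is
absorbed by the weights `(k + 2) / (2 * (k + 1))`, at the price of an additive error `m`. -/
lemma weighted_potential_step {k B C S S' R R' T m : ℝ} (hk : 0 ≤ k) (hB : 0 ≤ B)
    (hBk : B ≤ (k + 2) ^ 2) (hm : 0 ≤ m) (hS : -m ≤ S')
    (hstep : B * S' + (1 - 1 / (k + 2) ^ 2) * R' ≤ C * S + R)
    (hprev : (k + 2) / (2 * (k + 1)) * (C * S + R) ≤ T + m * k) :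
    (k + 3) / (2 * (k + 2)) * (B * S' + R') ≤ T + m * (k + 1) := by
  have hP : 0 ≤ (k + 2) / (2 * (k + 1)) := by positivity
  have h1 := mul_le_mul_of_nonneg_left hstep hP
  have hc : 0 ≤ 1 / (2 * (k + 1) * (k + 2)) := by positivity
  have h2 : -((k + 2) ^ 2 * m) ≤ B * S' := by nlinarith
  have h3 := mul_le_mul_of_nonneg_left h2 hc
  have h4 : 1 / (2 * (k + 1) * (k + 2)) * ((k + 2) ^ 2 * m) ≤ m := by
    rw [div_mul_eq_mul_div, div_le_iff₀ (by positivity)]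
    nlinarith [mul_nonneg hm (mul_nonneg hk hk), mul_nonneg hm hk]
  have h5 : (k + 2) / (2 * (k + 1)) * (B * S' + (1 - 1 / (k + 2) ^ 2) * R') =
      (k + 3) / (2 * (k + 2)) * (B * S' + R') + 1 / (2 * (k + 1) * (k + 2)) * (B * S') := by
    field_simp
    ring
  linarith


/-- Casimir convergence with constant smoothing in the non-strongly-convex case `λ = 0`
(Corollary 5.4 of the paper): with constant parameters `μ_k = μ`, `κ_k = κ`,
`α₀ = (√5 − 1)/2` and `δ_k = 1/(k+1)²`, one has
`F(w_k) − F* ≤ (8/(k+2)²)(F(w₀) − F* + (κ/2)‖w₀ − w*‖²) + μD(1 + 12/(k+2) + 30/(k+2)²)`. -/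
theorem casimir_convex_constant_smoothing
    {d : ℕ} (D : ℝ) (hD : 0 ≤ D)
    (G : ℝ → EuclideanSpace ℝ (Fin d) → ℝ)
    -- each `G ν` is convex (λ-strong convexity with λ = 0)
    (hSC : ∀ ν : ℝ, 0 ≤ ν → ∀ x y : EuclideanSpace ℝ (Fin d), ∀ t : ℝ, 0 ≤ t → t ≤ 1 →
      G ν (t • x + (1 - t) • y) ≤ t * G ν x + (1 - t) * G ν y)
    -- sandwich property of the smoothing
    (hsandwich : ∀ ν ν' : ℝ, 0 ≤ ν' → ν' ≤ ν → ∀ w : EuclideanSpace ℝ (Fin d),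
      0 ≤ G ν w - G ν' w ∧ G ν w - G ν' w ≤ (ν - ν') * D)
    -- `wstar` minimizes `F = G 0`
    (wstar : EuclideanSpace ℝ (Fin d)) (hstar : ∀ w, G 0 wstar ≤ G 0 w)
    -- constant parameters
    (μ κ : ℝ) (hμ : 0 ≤ μ) (hκ : 0 < κ)
    -- iterates
    (w z : ℕ → EuclideanSpace ℝ (Fin d)) (α : ℕ → ℝ)
    (hα0 : α 0 = (Real.sqrt 5 - 1) / 2)
    (hz0 : z 0 = w 0)
    -- (a) approximate proximal point step with `δ_k = 1/(k+1)²`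
    (hprox : ∀ k, 1 ≤ k → ∀ v : EuclideanSpace ℝ (Fin d),
      G μ (w k) + κ / 2 * ‖w k - z (k - 1)‖ ^ 2 ≤
        G μ v + κ / 2 * ‖v - z (k - 1)‖ ^ 2 +
          (1 / ((k : ℝ) + 1) ^ 2) * κ / 2 * ‖w k - z (k - 1)‖ ^ 2)
    -- (b) extrapolation coefficient recursion (with λ = 0)
    (hαrec : ∀ k, 1 ≤ k → 0 ≤ α k ∧
      α k ^ 2 * κ = (1 - α k) * α (k - 1) ^ 2 * κ)
    -- (c) extrapolation step (with λ = 0)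
    (hzrec : ∀ k, 1 ≤ k → z k = w k +
      (α (k - 1) * (1 - α (k - 1)) * κ /
        (α (k - 1) ^ 2 * κ + α k * κ)) • (w k - w (k - 1))) :
    ∀ k, 1 ≤ k →
      G 0 (w k) - G 0 wstar ≤
        8 / ((k : ℝ) + 2) ^ 2 * (G 0 (w 0) - G 0 wstar + κ / 2 * ‖w 0 - wstar‖ ^ 2) +
          μ * D * (1 + 12 / ((k : ℝ) + 2) + 30 / ((k : ℝ) + 2) ^ 2) := by
  have hα : ∀ k, 0 ≤ α (k + 1) ∧ α (k + 1) ^ 2 = (1 - α (k + 1)) * α k ^ 2 := fun k => by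
    obtain ⟨h0, h⟩ := hαrec (k + 1) (Nat.le_add_left 1 k)
    exact ⟨h0, mul_right_cancel₀ hκ.ne' h⟩
  have hbounds := extrapolation_coefficient_bounds hα0 hα
  have hsmooth := fun x => hsandwich μ 0 le_rfl hμ x
  simp only [sub_zero] at hsmooth
  have hm : 0 ≤ μ * D := mul_nonneg hμ hD
  -- the estimate-sequence points, characterised by `z k = α k • V k + (1 - α k) • w k`
  let V : ℕ → EuclideanSpace ℝ (Fin d) := fun k => w k + (α k)⁻¹ • (z k - w k)
  have hz : ∀ k, z k = α k • V k + (1 - α k) • w k := fun k => by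
    have h := (hbounds k).1.ne'
    simp only [V, smul_add, smul_smul, mul_inv_cancel₀ h]
    module
  have hV : ∀ k, w (k + 1) = α k • V (k + 1) + (1 - α k) • w k := fun k => by
    have ha := (hbounds k).1
    have hb := (hbounds (k + 1)).1
    have hβ : α k * ((α (k + 1))⁻¹ *
        (α k * (1 - α k) * κ / (α k ^ 2 * κ + α (k + 1) * κ))) = 1 - α k := by
      have hden : α k ^ 2 * κ + α (k + 1) * κ ≠ 0 := by positivity
      field_simp
      linear_combination (-(1 - α k)) * (hα k).2
    have hzk := hzrec (k + 1) (Nat.le_add_left 1 k)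
    rw [Nat.add_sub_cancel] at hzk
    simp only [V, hzk, add_sub_cancel_left, smul_add, smul_smul, hβ]
    module
  have hB : ∀ k, (1 - α (k + 1)) / α (k + 1) ^ 2 = 1 / α k ^ 2 := fun k => by
    have ha := (hbounds k).1
    have hb := (hbounds (k + 1)).1
    rw [div_eq_div_iff (by positivity) (by positivity), (hα k).2]
    ring
  have hrecur : ∀ k : ℕ,
      (1 - α (k + 1)) / α (k + 1) ^ 2 * (G μ (w (k + 1)) - G μ wstar) +
          (1 - 1 / ((k : ℝ) + 2) ^ 2) * (κ / 2 * ‖wstar - V (k + 1)‖ ^ 2) ≤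
        (1 - α k) / α k ^ 2 * (G μ (w k) - G μ wstar) + κ / 2 * ‖wstar - V k‖ ^ 2 := fun k => by
    obtain ⟨ha, hup, -⟩ := hbounds k
    have hk : (0 : ℝ) ≤ k := k.cast_nonneg
    have hp := hprox (k + 1) (Nat.le_add_left 1 k)
    rw [Nat.add_sub_cancel, Nat.cast_succ,
      show (k : ℝ) + 1 + 1 = k + 2 by ring] at hp
    have hδ : 1 / ((k : ℝ) + 2) ^ 2 ≤ 1 := by
      rw [div_le_one (by positivity)]
      nlinarith
    have h1 := le_of_relative_inexact_prox (hSC μ hμ) (by positivity) hδ hp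
      (α k • wstar + (1 - α k) • w k)
    have h2 := hSC μ hμ wstar (w k) (α k) ha.le (by nlinarith)
    have e1 : α k • wstar + (1 - α k) • w k - z k = α k • (wstar - V k) := by
      rw [hz k]
      module
    have e2 : α k • wstar + (1 - α k) • w k - w (k + 1) = α k • (wstar - V (k + 1)) := by
      rw [hV k]
      module
    rw [e1, e2, norm_smul, norm_smul, mul_pow, mul_pow, Real.norm_eq_abs, sq_abs] at h1
    rw [hB]
    refine le_of_mul_le_mul_left ?_ (pow_pos ha 2)
    have e3 : α k ^ 2 * (1 / α k ^ 2) = 1 := by field_simp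
    have e4 : α k ^ 2 * ((1 - α k) / α k ^ 2) = 1 - α k := by field_simp
    linear_combination h1 + h2 + (G μ (w (k + 1)) - G μ wstar) * e3 -
      (G μ (w k) - G μ wstar) * e4
  have hB0 : (1 - α 0) / α 0 ^ 2 = 1 := by
    have h5 : Real.sqrt 5 ^ 2 = 5 := Real.sq_sqrt (by norm_num)
    rw [div_eq_one_iff_eq (pow_pos (hbounds 0).1 2).ne', hα0]
    linear_combination (-1 / 4) * h5
  have hV0 : V 0 = w 0 := by simp [V, hz0]
  have hlower : ∀ x, -(μ * D) ≤ G μ x - G μ wstar := fun x => by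
    linarith [hstar x, (hsmooth x).1, (hsmooth wstar).2]
  set T := G 0 (w 0) - G 0 wstar + κ / 2 * ‖w 0 - wstar‖ ^ 2 with hT
  have hT0 : 0 ≤ T := add_nonneg (sub_nonneg.2 (hstar _)) (by positivity)
  have hpotential : ∀ k : ℕ, ((k : ℝ) + 2) / (2 * (k + 1)) *
      ((1 - α k) / α k ^ 2 * (G μ (w k) - G μ wstar) + κ / 2 * ‖wstar - V k‖ ^ 2) ≤
        (T + μ * D) + μ * D * k := fun k => by
    induction k with
    | zero =>
      rw [hB0, hV0, norm_sub_rev]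
      norm_num
      linarith [(hsmooth (w 0)).2, (hsmooth wstar).1]
    | succ k ih =>
      have ha := (hbounds k).1
      have hlow := (hbounds k).2.2
      have h := weighted_potential_step k.cast_nonneg (by rw [hB]; positivity)
        (by
          rw [hB, div_le_iff₀ (by positivity), ← mul_pow, mul_comm]
          exact one_le_pow₀ hlow) hm (hlower (w (k + 1))) (hrecur k) ih
      push_cast
      convert h using 3 <;> ring
  intro k hk
  obtain ⟨j, rfl⟩ := Nat.exists_eq_add_of_le' hk
  obtain ⟨ha, hup, -⟩ := hbounds j
  have hj : (0 : ℝ) ≤ j := j.cast_nonneg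
  have h := hpotential (j + 1)
  rw [hB] at h
  push_cast at h ⊢
  set S := G μ (w (j + 1)) - G μ wstar with hS
  set R := κ / 2 * ‖wstar - V (j + 1)‖ ^ 2
  have hR : 0 ≤ R := by positivity
  set Y := T + μ * D + μ * D * ((j : ℝ) + 1) with hY
  have hY0 : 0 ≤ Y := by positivity
  have hP : (1 : ℝ) / 2 ≤ ((j : ℝ) + 1 + 2) / (2 * (j + 1 + 1)) := by
    rw [div_le_div_iff₀ two_pos (by positivity)]
    linarith
  have hX : 1 / α j ^ 2 * S + R ≤ 2 * Y := by
    by_contra! hlt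
    nlinarith
  have hSY : S ≤ 2 * Y * α j ^ 2 := by
    rw [← div_le_iff₀ (by positivity), div_eq_inv_mul, ← one_div]
    linarith
  have hα2 : α j ^ 2 ≤ 4 / ((j : ℝ) + 1 + 2) ^ 2 := by
    rw [le_div_iff₀ (by positivity), ← mul_pow]
    nlinarith [mul_nonneg ha.le hj]
  have hfinal : S ≤ 2 * Y * (4 / ((j : ℝ) + 1 + 2) ^ 2) :=
    hSY.trans (mul_le_mul_of_nonneg_left hα2 (by positivity))
  have hlast : 0 ≤ μ * D * ((4 * ((j : ℝ) + 1 + 2) + 38) / ((j : ℝ) + 1 + 2) ^ 2) := by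
    positivity
  have hsplit : 8 / ((j : ℝ) + 1 + 2) ^ 2 * T +
      μ * D * (1 + 12 / ((j : ℝ) + 1 + 2) + 30 / ((j : ℝ) + 1 + 2) ^ 2) =
        2 * Y * (4 / ((j : ℝ) + 1 + 2) ^ 2) + μ * D +
          μ * D * ((4 * ((j : ℝ) + 1 + 2) + 38) / ((j : ℝ) + 1 + 2) ^ 2) := by
    rw [hY]
    field_simp
    ring
  linarith [(hsmooth (w (j + 1))).1, (hsmooth wstar).2]
end

section
/- Let λ ≥ 0, let (κ_k)_{k≥1} be a positive nondecreasing sequence of reals, and let (α_k)_{k≥0} be a sequence with α₀ ∈ (0,1), α₀² ≥ λ/(λ + κ₁), such that for every k ≥ 1, α_k ≥ 0 and α_k² (κ_{k+1} + λ) = (1 − α_k) α_{k−1}² (κ_k + λ) + α_k λ. Then for every k ≥ 1: 0 < α_k ≤ α_{k−1} < 1, and α_k² ≥ λ/(λ + κ_{k+1}). -/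
/-- One step of the quadratic update `x² B = (1 - x) a² A + x λ` keeps the root positive, does not
increase it, and preserves the lower bound `λ ≤ a² A`. -/
theorem quadratic_update_bounds {lam A B a x : ℝ} (hA : 0 < A) (hAB : A ≤ B) (ha : 0 < a)
    (ha1 : a < 1) (hlam : lam ≤ a ^ 2 * A) (hx : 0 ≤ x)
    (h : x ^ 2 * B = (1 - x) * a ^ 2 * A + x * lam) :
    0 < x ∧ x ≤ a ∧ lam ≤ x ^ 2 * B := by
  have haA : 0 < a ^ 2 * A := by positivity
  have hxa : x ≤ a := by
    have hsq : x ^ 2 * B ≤ a ^ 2 * B := by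
      nlinarith [mul_le_mul_of_nonneg_left hlam hx, mul_le_mul_of_nonneg_left hAB (sq_nonneg a)]
    exact (sq_le_sq₀ hx ha.le).mp (le_of_mul_le_mul_right hsq (hA.trans_le hAB))
  refine ⟨hx.lt_of_ne ?_, hxa, ?_⟩
  · rintro rfl
    linarith
  · nlinarith [mul_le_mul_of_nonneg_left hlam (by linarith : 0 ≤ 1 - x)]

/-- Behavior of the Casimir extrapolation coefficients (Lemma 5.6 of the paper):
if `α_k ≥ 0` solves `α_k²(κ_{k+1} + λ) = (1 − α_k) α_{k−1}² (κ_k + λ) + α_k λ` with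
`α₀ ∈ (0,1)`, `α₀² ≥ λ/(λ + κ₁)`, then `0 < α_k ≤ α_{k−1} < 1` and
`α_k² ≥ λ/(λ + κ_{k+1})` for all `k ≥ 1`. -/
theorem casimir_alpha_sequence (lam : ℝ) (hlam : 0 ≤ lam) (κ : ℕ → ℝ)
    (hκpos : ∀ k, 1 ≤ k → 0 < κ k) (hκmono : ∀ k, 1 ≤ k → κ k ≤ κ (k + 1))
    (α : ℕ → ℝ) (hα0pos : 0 < α 0) (hα0lt : α 0 < 1)
    (hα0sq : lam / (lam + κ 1) ≤ α 0 ^ 2)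
    (hrec : ∀ k, 1 ≤ k → 0 ≤ α k ∧
      α k ^ 2 * (κ (k + 1) + lam) = (1 - α k) * α (k - 1) ^ 2 * (κ k + lam) + α k * lam) :
    ∀ k, 1 ≤ k → (0 < α k ∧ α k ≤ α (k - 1) ∧ α (k - 1) < 1) ∧
      lam / (lam + κ (k + 1)) ≤ α k ^ 2 := by
  have step (k : ℕ) (ha : 0 < α k) (ha1 : α k < 1) (hl : lam ≤ α k ^ 2 * (κ (k + 1) + lam)) :
      0 < α (k + 1) ∧ α (k + 1) ≤ α k ∧ lam ≤ α (k + 1) ^ 2 * (κ (k + 2) + lam) := by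
    have hk : 1 ≤ k + 1 := by omega
    exact quadratic_update_bounds (add_pos_of_pos_of_nonneg (hκpos _ hk) hlam)
      (by linarith [hκmono _ hk]) ha ha1 hl (hrec _ hk).1 (hrec _ hk).2
  have bounds (k : ℕ) : 0 < α k ∧ α k < 1 ∧ lam ≤ α k ^ 2 * (κ (k + 1) + lam) := by
    induction k with
    | zero =>
      refine ⟨hα0pos, hα0lt, ?_⟩
      rwa [div_le_iff₀ (add_pos_of_nonneg_of_pos hlam (hκpos 1 le_rfl)), add_comm lam] at hα0sq
    | succ k ih =>
      obtain ⟨hpos, hle, hlow⟩ := step k ih.1 ih.2.1 ih.2.2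
      exact ⟨hpos, hle.trans_lt ih.2.1, hlow⟩
  intro k hk
  obtain ⟨j, rfl⟩ := Nat.exists_eq_add_of_le' hk
  obtain ⟨ha, ha1, hl⟩ := bounds j
  obtain ⟨hpos, hle, hlow⟩ := step j ha ha1 hl
  refine ⟨⟨hpos, hle, ha1⟩, ?_⟩
  rwa [div_le_iff₀ (add_pos_of_nonneg_of_pos hlam (hκpos _ (by omega))), add_comm lam]
end

section
/- Let G : ℝ^d → ℝ be λ-strongly convex for some λ ≥ 0, let κ > 0, z ∈ ℝ^d, and define Φ(w) = G(w) + (κ/2)‖w − z‖₂². Assume Φ attains its minimum over ℝ^d, and suppose ŵ ∈ ℝ^d satisfies Φ(ŵ) − inf_{w ∈ ℝ^d} Φ(w) ≤ ε̂ for some ε̂ > 0. Then for every θ ∈ (0,1) and every w ∈ ℝ^d: G(ŵ) + (κ/2)‖ŵ − z‖₂² + ((κ + λ)/2)(1 − θ)‖w − ŵ‖₂² ≤ G(w) + (κ/2)‖w − z‖₂² + ε̂/θ. -/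
/-- The squared distance to a point, evaluated along the segment between `x` and `y`. -/
theorem norm_sq_convex_combination_sub {E : Type*} [NormedAddCommGroup E] [InnerProductSpace ℝ E]
    (x y z : E) (t : ℝ) :
    ‖t • x + (1 - t) • y - z‖ ^ 2 =
      t * ‖x - z‖ ^ 2 + (1 - t) * ‖y - z‖ ^ 2 - t * (1 - t) * ‖x - y‖ ^ 2 := by
  have hcomb : t • x + (1 - t) • y - z = t • (x - z) + (1 - t) • (y - z) := by module
  have hdiff : x - y = (x - z) - (y - z) := by abel
  rw [hcomb, hdiff, norm_add_sq_real, norm_sub_sq_real (x - z), norm_smul, norm_smul,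
    mul_pow, mul_pow, Real.norm_eq_abs, Real.norm_eq_abs, sq_abs, sq_abs, real_inner_smul_left,
    real_inner_smul_right]
  ring

/-- Approximate proximal point descent lemma (Lemma 5.7 of the paper): if `ŵ` is an
`ε̂`-approximate minimizer of `Φ(w) = G(w) + (κ/2)‖w − z‖²` with `G` λ-strongly convex,
then for every `θ ∈ (0,1)` and every `w`,
`G(ŵ) + (κ/2)‖ŵ − z‖² + ((κ+λ)/2)(1−θ)‖w − ŵ‖² ≤ G(w) + (κ/2)‖w − z‖² + ε̂/θ`. -/
theorem approx_prox_descent {d : ℕ} (lam : ℝ) (hlam : 0 ≤ lam)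
    (G : EuclideanSpace ℝ (Fin d) → ℝ)
    (hG : ∀ x y : EuclideanSpace ℝ (Fin d), ∀ t : ℝ, 0 ≤ t → t ≤ 1 →
      G (t • x + (1 - t) • y) ≤ t * G x + (1 - t) * G y - lam / 2 * (t * (1 - t)) * ‖x - y‖ ^ 2)
    (κ : ℝ) (hκ : 0 < κ) (z : EuclideanSpace ℝ (Fin d))
    (wmin : EuclideanSpace ℝ (Fin d))
    (hmin : ∀ w, G wmin + κ / 2 * ‖wmin - z‖ ^ 2 ≤ G w + κ / 2 * ‖w - z‖ ^ 2)
    (what : EuclideanSpace ℝ (Fin d)) (εhat : ℝ) (hε : 0 < εhat)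
    (hwhat : G what + κ / 2 * ‖what - z‖ ^ 2 - (G wmin + κ / 2 * ‖wmin - z‖ ^ 2) ≤ εhat) :
    ∀ θ : ℝ, 0 < θ → θ < 1 → ∀ w : EuclideanSpace ℝ (Fin d),
      G what + κ / 2 * ‖what - z‖ ^ 2 + (κ + lam) / 2 * (1 - θ) * ‖w - what‖ ^ 2 ≤
        G w + κ / 2 * ‖w - z‖ ^ 2 + εhat / θ := by
  intro θ hθ hθ' w
  have hconv := hG w what θ hθ.le hθ'.le
  have hle := hmin (θ • w + (1 - θ) • what)
  rw [norm_sq_convex_combination_sub] at hle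
  have hdiv : θ * (εhat / θ) = εhat := mul_div_cancel₀ εhat hθ.ne'
  refine le_of_mul_le_mul_left ?_ hθ
  linarith
end

section
/- Let (α_k)_{k≥0} be the sequence of reals with α₀ = (√5 − 1)/2 and, for each k ≥ 1, α_k the positive root of α_k² = (1 − α_k) α_{k−1}². Then for every k ≥ 0: √2/(k+3) ≤ α_k ≤ 2/(k+3), and, setting A_k = Π_{j=0}^{k}(1 − α_j), 2/(k+3)² ≤ A_k ≤ 4/(k+3)². -/
/-- One step of the recursion `b² = (1 − b) a²` carries `a ≤ 2 / n` to `b ≤ 2 / (n + 1)`. -/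
lemma le_two_div_add_one_of_sq_eq {a b n : ℝ} (hn : 0 < n) (ha : 0 < a)
    (hab : b ^ 2 = (1 - b) * a ^ 2) (h : a ≤ 2 / n) : b ≤ 2 / (n + 1) := by
  rw [le_div_iff₀ (by positivity)] at h ⊢
  have hb1 : 0 ≤ 1 - b := by
    by_contra! hneg
    nlinarith [mul_neg_of_neg_of_pos hneg (pow_pos ha 2), sq_nonneg b]
  have hsq : (a * n) ^ 2 ≤ 2 ^ 2 := pow_le_pow_left₀ (by positivity) h 2
  have hbn : b ^ 2 * n ^ 2 ≤ 4 * (1 - b) := by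
    rw [hab]
    nlinarith [mul_le_mul_of_nonneg_left hsq hb1]
  by_contra! hlt
  have hlt_sq : 2 ^ 2 < (b * (n + 1)) ^ 2 := pow_lt_pow_left₀ hlt (by norm_num) (by norm_num)
  nlinarith [mul_le_mul_of_nonneg_right hbn (sq_nonneg (n + 1)),
    mul_lt_mul_of_pos_right hlt_sq (pow_pos hn 2),
    mul_lt_mul_of_pos_right hlt (by positivity : 0 < n + 1)]

/-- One step of the recursion `b² = (1 − b) a²` carries `√2 / n ≤ a` to `√2 / (n + 1) ≤ b`. -/
lemma sqrt_two_div_add_one_le_of_sq_eq {a b n : ℝ} (hn : 3 ≤ n) (ha : 0 < a) (hb : 0 < b)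
    (hab : b ^ 2 = (1 - b) * a ^ 2) (h : √2 / n ≤ a) : √2 / (n + 1) ≤ b := by
  have hn0 : 0 < n := by linarith
  rw [div_le_iff₀ (by positivity)] at h ⊢
  have hs : √2 ^ 2 = 2 := Real.sq_sqrt (by norm_num)
  have hs_le : √2 ≤ 3 / 2 := Real.sqrt_le_iff.mpr (by norm_num)
  have hb1 : 0 ≤ 1 - b := by
    by_contra! hneg
    nlinarith [mul_neg_of_neg_of_pos hneg (pow_pos ha 2), sq_nonneg b]
  have hsq : √2 ^ 2 ≤ (a * n) ^ 2 := pow_le_pow_left₀ (by positivity) h 2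
  rw [hs] at hsq
  have hbn : 2 * (1 - b) ≤ b ^ 2 * n ^ 2 := by
    rw [hab]
    nlinarith [mul_le_mul_of_nonneg_left hsq hb1]
  by_contra! hlt
  have hlt_sq : (b * (n + 1)) ^ 2 < √2 ^ 2 := pow_lt_pow_left₀ hlt (by positivity) (by norm_num)
  rw [hs] at hlt_sq
  nlinarith [mul_le_mul_of_nonneg_right hbn (sq_nonneg (n + 1)),
    mul_lt_mul_of_pos_right hlt_sq (pow_pos hn0 2),
    mul_lt_mul_of_pos_right hlt (by positivity : 0 < n + 1),
    mul_le_mul_of_nonneg_right hs_le (by positivity : 0 ≤ n + 1)]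

/-- The recursion telescopes the partial products of `1 − α j` to `(α k)²`. -/
lemma prod_range_one_sub_eq_sq {α : ℕ → ℝ} (h0 : α 0 ^ 2 = 1 - α 0)
    (hstep : ∀ k, α (k + 1) ^ 2 = (1 - α (k + 1)) * α k ^ 2) (k : ℕ) :
    ∏ j ∈ Finset.range (k + 1), (1 - α j) = α k ^ 2 := by
  induction k with
  | zero => simp [h0]
  | succ k ih => rw [Finset.prod_range_succ, ih, hstep k, mul_comm]


/-- Rate of the Casimir extrapolation coefficients with constant regularization
(Lemma D.2 of the paper): with `α₀ = (√5 − 1)/2` and `α_k` the positive root of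
`α_k² = (1 − α_k) α_{k−1}²`, one has `√2/(k+3) ≤ α_k ≤ 2/(k+3)` and
`2/(k+3)² ≤ A_k ≤ 4/(k+3)²` where `A_k = Π_{j=0}^k (1 − α_j)`. -/
theorem alpha_sequence_const_kappa (α : ℕ → ℝ)
    (hα0 : α 0 = (Real.sqrt 5 - 1) / 2)
    (hrec : ∀ k, 1 ≤ k → 0 < α k ∧ α k ^ 2 = (1 - α k) * α (k - 1) ^ 2) :
    ∀ k : ℕ,
      (Real.sqrt 2 / ((k : ℝ) + 3) ≤ α k ∧ α k ≤ 2 / ((k : ℝ) + 3)) ∧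
      (2 / ((k : ℝ) + 3) ^ 2 ≤ ∏ j ∈ Finset.range (k + 1), (1 - α j) ∧
        ∏ j ∈ Finset.range (k + 1), (1 - α j) ≤ 4 / ((k : ℝ) + 3) ^ 2) := by
  have h5 : √5 ^ 2 = 5 := Real.sq_sqrt (by norm_num)
  have h5_ge : 2.23 ≤ √5 := Real.le_sqrt_of_sq_le (by norm_num)
  have h5_le : √5 ≤ 7 / 3 := Real.sqrt_le_iff.mpr (by norm_num)
  have h2_le : √2 ≤ 3 / 2 := Real.sqrt_le_iff.mpr (by norm_num)
  have hstep : ∀ k, α (k + 1) ^ 2 = (1 - α (k + 1)) * α k ^ 2 :=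
    fun k => (hrec (k + 1) (by omega)).2
  have hpos : ∀ k, 0 < α k
    | 0 => by rw [hα0]; linarith
    | k + 1 => (hrec (k + 1) (by omega)).1
  have hbounds : ∀ k : ℕ, √2 / ((k : ℝ) + 3) ≤ α k ∧ α k ≤ 2 / ((k : ℝ) + 3) := by
    intro k
    induction k with
    | zero =>
      rw [hα0]
      constructor <;> norm_num <;> linarith
    | succ k ih =>
      have hcast : ((k + 1 : ℕ) : ℝ) + 3 = (k : ℝ) + 3 + 1 := by push_cast; ring
      rw [hcast]
      exact ⟨sqrt_two_div_add_one_le_of_sq_eq (by linarith [k.cast_nonneg (α := ℝ)])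
          (hpos k) (hpos (k + 1)) (hstep k) ih.1,
        le_two_div_add_one_of_sq_eq (by positivity) (hpos k) (hstep k) ih.2⟩
  intro k
  obtain ⟨hlo, hhi⟩ := hbounds k
  refine ⟨⟨hlo, hhi⟩, ?_⟩
  rw [prod_range_one_sub_eq_sq (by rw [hα0]; linarith) hstep]
  have hlo_sq := pow_le_pow_left₀ (by positivity) hlo 2
  have hhi_sq := pow_le_pow_left₀ (hpos k).le hhi 2
  rw [div_pow, Real.sq_sqrt (by norm_num)] at hlo_sq
  rw [div_pow] at hhi_sq
  norm_num at hhi_sq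
  exact ⟨hlo_sq, hhi_sq⟩
end

section
/- Let (α_k)_{k≥0} be the sequence of reals with α₀ = (√5 − 1)/2 and, for each k ≥ 1, α_k the nonnegative root of α_k² (k+1) = (1 − α_k) α_{k−1}² k (equivalently α_k²/(1 − α_k) = α_{k−1}² · k/(k+1)). Then, setting A_k = Π_{i=0}^{k}(1 − α_i), for every k ≥ 0: (1 − 1/√2)/(k+1) ≤ A_k ≤ 1/(k+2). -/
/-- Products of `1 - α i` in closed form, when `α 0 ^ 2 = 1 - α 0`. -/
theorem prod_one_sub_eq_mul_sq (α : ℕ → ℝ) (h0 : α 0 ^ 2 = 1 - α 0)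
    (hrec : ∀ k : ℕ, α (k + 1) ^ 2 * ((k : ℝ) + 2) = (1 - α (k + 1)) * α k ^ 2 * ((k : ℝ) + 1))
    (k : ℕ) : ∏ i ∈ Finset.range (k + 1), (1 - α i) = ((k : ℝ) + 1) * α k ^ 2 := by
  induction k with
  | zero => simp [h0]
  | succ k ih =>
    rw [Finset.prod_range_succ, ih]
    push_cast
    linear_combination -hrec k

/-- One step of the upper bound: if `A ≤ 1 / n` then `A (1 - a) ≤ 1 / (n + 1)`. -/
theorem mul_one_sub_le_of_eq_mul_sq {A a n : ℝ} (hn : 0 < n) (ha : 0 ≤ a) (ha1 : a ≤ 1)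
    (hA : A ≤ 1 / n) (h : A * (1 - a) = n * a ^ 2) : A * (1 - a) ≤ 1 / (n + 1) := by
  rcases le_total a (1 / (n + 1)) with hle | hge
  · calc A * (1 - a) = n * a ^ 2 := h
      _ ≤ n * (1 / (n + 1)) ^ 2 := by gcongr
      _ ≤ 1 / (n + 1) := by
        rw [div_pow, one_pow, mul_one_div, div_le_div_iff₀ (by positivity) (by positivity)]
        nlinarith
  · calc A * (1 - a) ≤ 1 / n * (1 - 1 / (n + 1)) :=
        mul_le_mul hA (by linarith) (by linarith) (by positivity)
      _ = 1 / (n + 1) := by field_simp; ring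

/-- One step of the lower bound: if `c / n ≤ A` then `c / (n + 1) ≤ A (1 - a)`. -/
theorem le_mul_one_sub_of_eq_mul_sq {A a c n : ℝ} (hn : 0 < n) (hc0 : 0 ≤ c) (hc1 : c ≤ 1)
    (hA : c / n ≤ A) (h : A * (1 - a) = (n + 1) * a ^ 2) : c / (n + 1) ≤ A * (1 - a) := by
  rcases le_total a (1 / (n + 1)) with hle | hge
  · have hlt : 1 / (n + 1) ≤ 1 := by
      rw [div_le_one (by positivity)]
      linarith
    calc c / (n + 1) = c / n * (1 - 1 / (n + 1)) := by field_simp; ring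
      _ ≤ A * (1 - a) :=
        mul_le_mul hA (by linarith) (by linarith) (le_trans (by positivity) hA)
  · calc c / (n + 1) ≤ 1 / (n + 1) := by gcongr
      _ = (n + 1) * (1 / (n + 1)) ^ 2 := by field_simp
      _ ≤ (n + 1) * a ^ 2 := by gcongr
      _ = A * (1 - a) := h.symm

/-- Rate of the Casimir extrapolation coefficients with linearly increasing regularization
(Lemma D.3 of the paper): with `α₀ = (√5 − 1)/2` and `α_k` the nonnegative root of
`α_k² (k+1) = (1 − α_k) α_{k−1}² k`, the products `A_k = Π_{i=0}^k (1 − α_i)` satisfy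
`(1 − 1/√2)/(k+1) ≤ A_k ≤ 1/(k+2)`. -/
theorem alpha_sequence_increasing_kappa (α : ℕ → ℝ)
    (hα0 : α 0 = (Real.sqrt 5 - 1) / 2)
    (hrec : ∀ k, 1 ≤ k → 0 ≤ α k ∧
      α k ^ 2 * ((k : ℝ) + 1) = (1 - α k) * α (k - 1) ^ 2 * (k : ℝ)) :
    ∀ k : ℕ,
      (1 - 1 / Real.sqrt 2) / ((k : ℝ) + 1) ≤ ∏ i ∈ Finset.range (k + 1), (1 - α i) ∧
        ∏ i ∈ Finset.range (k + 1), (1 - α i) ≤ 1 / ((k : ℝ) + 2) := by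
  have hc1 : 1 - 1 / Real.sqrt 2 ≤ 1 := sub_le_self _ (by positivity)
  have hs2 : 1 / Real.sqrt 2 = Real.sqrt 2 / 2 := by
    rw [div_eq_div_iff (by positivity) (by positivity)]
    simp
  have h2 : (1.41 : ℝ) ≤ Real.sqrt 2 := Real.le_sqrt_of_sq_le (by norm_num)
  have h2' : Real.sqrt 2 ≤ 2 := Real.sqrt_le_iff.2 (by norm_num)
  have h5 : (2 : ℝ) ≤ Real.sqrt 5 := Real.le_sqrt_of_sq_le (by norm_num)
  have h5' : Real.sqrt 5 ≤ 2.24 := Real.sqrt_le_iff.2 (by norm_num)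
  have hc0 : 0 ≤ 1 - 1 / Real.sqrt 2 := by rw [hs2]; linarith
  have hα0_sq : α 0 ^ 2 = 1 - α 0 := by
    rw [hα0]
    linear_combination (1 / 4) * Real.sq_sqrt (show (0 : ℝ) ≤ 5 by norm_num)
  have hstep : ∀ k : ℕ,
      α (k + 1) ^ 2 * ((k : ℝ) + 2) = (1 - α (k + 1)) * α k ^ 2 * ((k : ℝ) + 1) := by
    intro k
    have h := (hrec (k + 1) (Nat.le_add_left 1 k)).2
    rw [Nat.add_sub_cancel] at h
    push_cast at h
    linear_combination h
  have hprod := prod_one_sub_eq_mul_sq α hα0_sq hstep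
  intro k
  induction k with
  | zero =>
    simp only [zero_add, Finset.prod_range_one, Nat.cast_zero, hα0, hs2]
    constructor <;> linarith
  | succ k ih =>
    have hnonneg := (hrec (k + 1) (Nat.le_add_left 1 k)).1
    have hk : (0 : ℝ) < (k : ℝ) + 1 := by positivity
    have hle : α (k + 1) ≤ 1 := by
      by_contra! hlt
      have hpos : 0 < α (k + 1) ^ 2 * ((k : ℝ) + 2) := by positivity
      have hneg : (1 - α (k + 1)) * (α k ^ 2 * ((k : ℝ) + 1)) ≤ 0 :=
        mul_nonpos_of_nonpos_of_nonneg (by linarith) (by positivity)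
      linarith [hstep k]
    have hsq := hprod (k + 1)
    rw [Finset.prod_range_succ] at hsq ⊢
    push_cast at hsq ⊢
    have hadd : (k : ℝ) + 1 + 2 = (k : ℝ) + 2 + 1 := by ring
    refine ⟨le_mul_one_sub_of_eq_mul_sq hk hc0 hc1 ih.1 hsq, ?_⟩
    rw [hadd]
    exact mul_one_sub_le_of_eq_mul_sq (by positivity) hnonneg hle ih.2
      (by linear_combination hsq)
end

section
/- Let Y be a finite nonempty type, let L ≥ 0, and let ψ : Y → ℝ^d → ℝ be such that for each y ∈ Y the map w ↦ ψ(y, w) is differentiable on ℝ^d with L-Lipschitz gradient, i.e. ‖∇_w ψ(y, w) − ∇_w ψ(y, w')‖₂ ≤ L ‖w − w'‖₂ for all w, w' ∈ ℝ^d. Then for all w, z ∈ ℝ^d: | max_{y ∈ Y} ψ(y, w + z) − max_{y ∈ Y} ( ψ(y, w) + ⟨∇_w ψ(y, w), z⟩ ) | ≤ (L/2) ‖z‖₂². -/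
open scoped RealInnerProductSpace in
/-- A differentiable function with `L`-Lipschitz gradient is approximated by its first-order Taylor
polynomial up to `L / 2 * ‖z‖ ^ 2`. -/
lemma abs_sub_add_inner_gradient_le {E : Type*} [NormedAddCommGroup E] [InnerProductSpace ℝ E]
    [CompleteSpace E] {L : ℝ} {f : E → ℝ} (hf : Differentiable ℝ f)
    (hlip : ∀ w w' : E, ‖gradient f w - gradient f w'‖ ≤ L * ‖w - w'‖) (w z : E) :
    |f (w + z) - (f w + ⟪gradient f w, z⟫)| ≤ L / 2 * ‖z‖ ^ 2 := by
  have hderiv (t : ℝ) : HasDerivAt (fun t : ℝ => f (w + t • z) - (f w + t * ⟪gradient f w, z⟫))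
      ⟪gradient f (w + t • z) - gradient f w, z⟫ t := by
    have hline : HasDerivAt (fun t : ℝ => w + t • z) z t := by
      simpa using ((hasDerivAt_id t).smul_const z).const_add w
    have hcomp := (hf (w + t • z)).hasGradientAt.hasFDerivAt.comp_hasDerivAt t hline
    rw [InnerProductSpace.toDual_apply_apply] at hcomp
    rw [inner_sub_left]
    exact hcomp.sub ((hasDerivAt_mul_const ⟪gradient f w, z⟫).const_add (f w))
  have hbound (t : ℝ) : HasDerivAt (fun t : ℝ => L / 2 * ‖z‖ ^ 2 * t ^ 2) (L * ‖z‖ ^ 2 * t) t := by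
    refine ((hasDerivAt_pow 2 t).const_mul (L / 2 * ‖z‖ ^ 2)).congr_deriv ?_
    norm_num
    ring
  have hle := image_norm_le_of_norm_deriv_right_le_deriv_boundary (a := 0) (b := 1)
    (fun t _ => (hderiv t).continuousAt.continuousWithinAt)
    (fun t _ => (hderiv t).hasDerivWithinAt) (by simp) hbound
    (fun t ht => by
      calc ‖⟪gradient f (w + t • z) - gradient f w, z⟫‖
          ≤ ‖gradient f (w + t • z) - gradient f w‖ * ‖z‖ := norm_inner_le_norm _ _
        _ ≤ L * ‖w + t • z - w‖ * ‖z‖ := by gcongr; exact hlip _ _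
        _ = L * ‖z‖ ^ 2 * t := by
          rw [add_sub_cancel_left, norm_smul, Real.norm_of_nonneg ht.1]
          ring)
    (Set.right_mem_Icc.2 zero_le_one)
  simpa using hle

/-- The maximum over a nonempty finite set is `1`-Lipschitz for the sup norm. -/
lemma Finset.abs_sup'_sub_sup'_le {ι : Type*} {s : Finset ι} (hs : s.Nonempty) {f g : ι → ℝ}
    {C : ℝ} (h : ∀ i ∈ s, |f i - g i| ≤ C) : |s.sup' hs f - s.sup' hs g| ≤ C := by
  have hle {f g : ι → ℝ} (h : ∀ i ∈ s, |f i - g i| ≤ C) : s.sup' hs f ≤ C + s.sup' hs g :=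
    Finset.sup'_le hs f fun i hi => by
      linarith [(abs_le.1 (h i hi)).2, Finset.le_sup' g hi]
  rw [abs_sub_le_iff, sub_le_iff_le_add, sub_le_iff_le_add]
  exact ⟨hle h, hle fun i hi => abs_sub_comm (f i) (g i) ▸ h i hi⟩

/-- Quadratic accuracy of the linearized model of the structural hinge loss
(Lemma 6.1 of the paper): if each score `w ↦ ψ(y, w)` is differentiable with `L`-Lipschitz
gradient, then
`|max_y ψ(y, w+z) − max_y (ψ(y, w) + ⟨∇ψ(y, w), z⟩)| ≤ (L/2)‖z‖²`. -/
theorem hinge_loss_prox_linear_model {d : ℕ} {Y : Type*} [Fintype Y] [Nonempty Y]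
    (L : ℝ) (hL : 0 ≤ L)
    (ψ : Y → EuclideanSpace ℝ (Fin d) → ℝ)
    (hdiff : ∀ y, Differentiable ℝ (ψ y))
    (hlip : ∀ y, ∀ w w' : EuclideanSpace ℝ (Fin d),
      ‖gradient (ψ y) w - gradient (ψ y) w'‖ ≤ L * ‖w - w'‖)
    (w z : EuclideanSpace ℝ (Fin d)) :
    |Finset.univ.sup' Finset.univ_nonempty (fun y => ψ y (w + z)) -
        Finset.univ.sup' Finset.univ_nonempty
          (fun y => ψ y w + @inner ℝ _ _ (gradient (ψ y) w) z)| ≤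
      L / 2 * ‖z‖ ^ 2 := by
  exact Finset.abs_sup'_sub_sup'_le _ fun y _ =>
    abs_sub_add_inner_gradient_le (hdiff y) (hlip y) w z
end

section
/- Let S₁ and S₂ be finite nonempty sets, let f : S₁ → ℝ and h : S₁ × S₂ → ℝ, and let k ≥ 1 be an integer. Then max^{(k)}_{(u₁,u₂) ∈ S₁ × S₂} ( f(u₁) + h(u₁, u₂) ) = max^{(k)}_{(u₁,ℓ) ∈ S₁ × {1,…,k}} ( f(u₁) + max^{(ℓ)}_{u₂ ∈ S₂} h(u₁, u₂) ), where both sides are interpreted in the extended reals ℝ ∪ {−∞} with the conventions below. -/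
noncomputable section

/-- The `k`-th largest element (1-indexed, counted with multiplicity) of a multiset of
extended reals `ℝ ∪ {−∞}`, with the convention that it is `−∞` when `k` exceeds the
cardinality. -/
def kthLargest (s : Multiset (WithBot ℝ)) (k : ℕ) : WithBot ℝ :=
  ((s.sort (· ≤ ·)).reverse).getD (k - 1) ⊥

/-- In a list sorted in decreasing order, the `i`-th entry (with default `⊥`) is at least `a ≠ ⊥`
iff more than `i` entries are at least `a`. -/
theorem List.Pairwise.le_getD_bot_iff {α : Type*} [LinearOrder α] [OrderBot α] {a : α}
    (ha : a ≠ ⊥) {l : List α} (hl : l.Pairwise (· ≥ ·)) (i : ℕ) :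
    a ≤ l.getD i ⊥ ↔ i < l.countP (a ≤ ·) := by
  induction l generalizing i with
  | nil => simpa using ha
  | cons x t ih =>
    obtain ⟨hx, ht⟩ := List.pairwise_cons.1 hl
    by_cases hax : a ≤ x
    · cases i with
      | zero => simp [hax]
      | succ i => simpa [hax] using ih ht i
    · have h0 : t.countP (a ≤ ·) = 0 :=
        List.countP_eq_zero.2 fun y hy => by simpa using (hx y hy).trans_lt (not_le.1 hax)
      cases i with
      | zero => simp [hax, h0]
      | succ i => simpa [hax, h0] using ih ht i

theorem coe_le_kthLargest_succ_iff (s : Multiset (WithBot ℝ)) (i : ℕ) (a : ℝ) :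
    (a : WithBot ℝ) ≤ kthLargest s (i + 1) ↔ i < s.countP ((a : WithBot ℝ) ≤ ·) := by
  have hl : (s.sort (· ≤ ·)).reverse.Pairwise (· ≥ ·) :=
    List.pairwise_reverse.2 (s.pairwise_sort (· ≤ ·))
  rw [kthLargest, Nat.add_sub_cancel, hl.le_getD_bot_iff (WithBot.coe_ne_bot),
    List.countP_reverse, ← Multiset.coe_countP, Multiset.sort_eq]

theorem coe_le_kthLargest_map_univ_iff {ι : Type*} [Fintype ι] (g : ι → WithBot ℝ) (i : ℕ)
    (a : ℝ) :
    (a : WithBot ℝ) ≤ kthLargest (Multiset.map g Finset.univ.val) (i + 1) ↔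
      i < (Finset.univ.filter fun x => (a : WithBot ℝ) ≤ g x).card := by
  rw [coe_le_kthLargest_succ_iff, Multiset.countP_map]
  rfl

theorem WithBot.coe_le_coe_add_iff_coe_sub_le (a c : ℝ) (y : WithBot ℝ) :
    (a : WithBot ℝ) ≤ c + y ↔ ((a - c : ℝ) : WithBot ℝ) ≤ y := by
  induction y with
  | bot => simp
  | coe y => rw [← WithBot.coe_add, WithBot.coe_le_coe, WithBot.coe_le_coe, sub_le_iff_le_add']

theorem Finset.card_filter_univ_prod {α β : Type*} [Fintype α] [Fintype β] (p : α × β → Prop)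
    [DecidablePred p] :
    (Finset.univ.filter p).card =
      ∑ x, (Finset.univ.filter fun y => p (x, y)).card := by
  simp only [Finset.card_filter, Fintype.sum_prod_type]

/-- Truncating the summands at `k` does not affect whether a sum reaches `k`. -/
theorem Finset.le_sum_min_iff {ι : Type*} (s : Finset ι) (n : ι → ℕ) (k : ℕ) :
    k ≤ ∑ x ∈ s, min (n x) k ↔ k ≤ ∑ x ∈ s, n x := by
  refine ⟨fun hk => hk.trans (Finset.sum_le_sum fun x _ => min_le_left _ _), fun hk => ?_⟩
  by_cases hn : ∃ x ∈ s, k ≤ n x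
  · obtain ⟨x, hx, hkx⟩ := hn
    calc k = min (n x) k := (min_eq_right hkx).symm
      _ ≤ _ := Finset.single_le_sum (f := fun x => min (n x) k) (fun _ _ => Nat.zero_le _) hx
  · push Not at hn
    rwa [Finset.sum_congr rfl fun x hx => min_eq_left (hn x hx).le]

/-- The generalized Bellman principle of optimality (identity (38) of the paper):
the `k`-th largest value of `f(u₁) + h(u₁, u₂)` over `S₁ × S₂` equals the `k`-th largest,
over `u₁ ∈ S₁` and rank indices `ℓ ∈ {1,…,k}`, of `f(u₁)` plus the `ℓ`-th largest value of
`h(u₁, ·)`; here sums involving `−∞` equal `−∞`. -/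
theorem kthLargest_bellman {S₁ S₂ : Type*} [Fintype S₁] [Fintype S₂]
    [Nonempty S₁] [Nonempty S₂]
    (f : S₁ → ℝ) (h : S₁ × S₂ → ℝ) (k : ℕ) (hk : 1 ≤ k) :
    kthLargest
        (Multiset.map (fun p : S₁ × S₂ => ((f p.1 + h p : ℝ) : WithBot ℝ))
          Finset.univ.val) k =
      kthLargest
        (Multiset.map (fun q : S₁ × Fin k =>
            (f q.1 : WithBot ℝ) +
              kthLargest
                (Multiset.map (fun u₂ : S₂ => ((h (q.1, u₂) : ℝ) : WithBot ℝ))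
                  Finset.univ.val) ((q.2 : ℕ) + 1))
          Finset.univ.val) k := by
  obtain ⟨m, rfl⟩ := Nat.exists_eq_add_of_le' hk
  refine WithBot.eq_of_forall_coe_le_iff fun a => ?_
  simp only [coe_le_kthLargest_map_univ_iff, WithBot.coe_le_coe_add_iff_coe_sub_le,
    Finset.card_filter_univ_prod, WithBot.coe_le_coe, sub_le_iff_le_add', Fin.card_filter_val_lt]
  simp only [← Nat.succ_le_iff, min_comm (m + 1)]
  exact (Finset.le_sum_min_iff Finset.univ _ (m + 1)).symm
end
end
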